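/- arXiv:math/0110316 — 12 statements merged into one kernel-verified Lean document; each statement's English description precedes it below -/
import Mathlib

section
/- Let M be a model category and let A and B be cofibrant objects of M. A morphism f : A → B is a weak equivalence if and only if for every fibrant object X and every morphism α : A → X there exists a morphism β : B → X, unique up to homotopy, such that β ∘ f is homotopic to α. -/
open CategoryTheory CategoryTheory.Limits

universe w v u v₂ u₂ v₃ u₃

/-- A morphism `f` is a retract of a morphism `g` (in the arrow category). -/
def IsRetractOfArrow {C : Type*} [Category C] {X Y X' Y' : C}
    (f : X ⟶ Y) (g : X' ⟶ Y') : Prop :=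
  ∃ (a : X ⟶ X') (a' : X' ⟶ X) (b : Y ⟶ Y') (b' : Y' ⟶ Y),
    a ≫ a' = 𝟙 X ∧ b ≫ b' = 𝟙 Y ∧ a ≫ g = f ≫ b ∧ a' ≫ f = g ≫ b'

/-- A (Quillen) model structure on a category `M`: three distinguished classes of
morphisms (weak equivalences, fibrations and cofibrations) subject to the axioms
MC2–MC5 (two-out-of-three, retract stability, lifting and factorization).
Bicompleteness (MC1) is imposed separately via `HasLimits`/`HasColimits`. -/
structure ModelStructure (M : Type u) [Category.{v} M] where
  weq : MorphismProperty M
  fib : MorphismProperty M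
  cof : MorphismProperty M
  weq_of_isIso : ∀ {X Y : M} (f : X ⟶ Y), IsIso f → weq f
  weq_comp : ∀ {X Y Z : M} (f : X ⟶ Y) (g : Y ⟶ Z), weq f → weq g → weq (f ≫ g)
  weq_of_comp_left : ∀ {X Y Z : M} (f : X ⟶ Y) (g : Y ⟶ Z), weq f → weq (f ≫ g) → weq g
  weq_of_comp_right : ∀ {X Y Z : M} (f : X ⟶ Y) (g : Y ⟶ Z), weq g → weq (f ≫ g) → weq f
  weq_retract : ∀ {X Y X' Y' : M} {f : X ⟶ Y} {g : X' ⟶ Y'},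
    IsRetractOfArrow f g → weq g → weq f
  fib_retract : ∀ {X Y X' Y' : M} {f : X ⟶ Y} {g : X' ⟶ Y'},
    IsRetractOfArrow f g → fib g → fib f
  cof_retract : ∀ {X Y X' Y' : M} {f : X ⟶ Y} {g : X' ⟶ Y'},
    IsRetractOfArrow f g → cof g → cof f
  lifting_cof_acyclicFib : ∀ {A B X Y : M} (i : A ⟶ B) (p : X ⟶ Y),
    cof i → fib p → weq p → HasLiftingProperty i p
  lifting_acyclicCof_fib : ∀ {A B X Y : M} (i : A ⟶ B) (p : X ⟶ Y),
    cof i → weq i → fib p → HasLiftingProperty i p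
  factorization_cof_acyclicFib : ∀ {X Y : M} (f : X ⟶ Y),
    ∃ (Z : M) (i : X ⟶ Z) (p : Z ⟶ Y), cof i ∧ fib p ∧ weq p ∧ i ≫ p = f
  factorization_acyclicCof_fib : ∀ {X Y : M} (f : X ⟶ Y),
    ∃ (Z : M) (i : X ⟶ Z) (p : Z ⟶ Y), cof i ∧ weq i ∧ fib p ∧ i ≫ p = f

variable {M : Type u} [Category.{v} M]

/-- An object is cofibrant if the map from the initial object to it is a cofibration. -/
def ModelStructure.Cofibrant [HasInitial M] (ms : ModelStructure M) (A : M) : Prop :=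
  ms.cof (initial.to A)

/-- An object is fibrant if the map to the terminal object is a fibration. -/
def ModelStructure.Fibrant [HasTerminal M] (ms : ModelStructure M) (X : M) : Prop :=
  ms.fib (terminal.from X)

/-- Maps `f, g : X ⟶ Y` are left homotopic if `f ⊔ g : X ⊔ X ⟶ Y` factors through a
cylinder object of `X`, i.e. through a factorization of the fold map `X ⊔ X ⟶ X` into a
cofibration followed by a weak equivalence. -/
def LeftHomotopic [HasBinaryCoproducts M] (ms : ModelStructure M) {X Y : M}
    (f g : X ⟶ Y) : Prop :=
  ∃ (Cyl : M) (i : X ⨿ X ⟶ Cyl) (p : Cyl ⟶ X) (H : Cyl ⟶ Y),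
    ms.cof i ∧ ms.weq p ∧ i ≫ p = coprod.desc (𝟙 X) (𝟙 X) ∧ i ≫ H = coprod.desc f g

/-- Maps `f, g : X ⟶ Y` are right homotopic if `(f, g) : X ⟶ Y × Y` factors through a
mapping (path) object of `Y`, i.e. through a factorization of the diagonal `Y ⟶ Y × Y`
into a weak equivalence followed by a fibration. -/
def RightHomotopic [HasBinaryProducts M] (ms : ModelStructure M) {X Y : M}
    (f g : X ⟶ Y) : Prop :=
  ∃ (P : M) (s : Y ⟶ P) (q : P ⟶ Y ⨯ Y) (G : X ⟶ P),
    ms.weq s ∧ ms.fib q ∧ s ≫ q = prod.lift (𝟙 Y) (𝟙 Y) ∧ G ≫ q = prod.lift f g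

/-- Homotopy of maps from a cofibrant object to a fibrant object (where the notions of
left and right homotopy coincide), here taken to be left homotopy. -/
def Homotopic [HasBinaryCoproducts M] (ms : ModelStructure M) {X Y : M}
    (f g : X ⟶ Y) : Prop :=
  LeftHomotopic ms f g


section Aux
open HomotopicalAlgebra

lemma aux_isRetract {C : Type*} [Category C] {X Y Z W : C} {f : X ⟶ Y} {g : Z ⟶ W}
    (h : RetractArrow f g) : IsRetractOfArrow f g :=
  ⟨h.i.left, h.r.left, h.i.right, h.r.right, h.retract_left, h.retract_right,
    h.i_w, h.r_w⟩

@[reducible] def ModelStructure.toModelCategory [HasLimits M] [HasColimits M]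
    (ms : ModelStructure M) : ModelCategory M :=
  { categoryWithFibrations := ⟨ms.fib⟩
    categoryWithCofibrations := ⟨ms.cof⟩
    categoryWithWeakEquivalences := ⟨ms.weq⟩
    cm2 :=
      { comp_mem := fun f g hf hg => ms.weq_comp f g hf hg
        of_postcomp := fun f g hg hfg => ms.weq_of_comp_right f g hg hfg
        of_precomp := fun f g hf hfg => ms.weq_of_comp_left f g hf hfg }
    cm3a := ⟨fun h hg => ms.weq_retract (aux_isRetract h) hg⟩
    cm3b := ⟨fun h hg => ms.fib_retract (aux_isRetract h) hg⟩
    cm3c := ⟨fun h hg => ms.cof_retract (aux_isRetract h) hg⟩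
    cm4a := fun i p hi hi' hp => ms.lifting_acyclicCof_fib i p hi.mem hi'.mem hp.mem
    cm4b := fun i p hi hp hp' => ms.lifting_cof_acyclicFib i p hi.mem hp.mem hp'.mem
    cm5a := ⟨fun f => by
      obtain ⟨Z, i, p, h1, h2, h3, h4⟩ := ms.factorization_acyclicCof_fib f
      exact ⟨⟨Z, i, p, h4, ⟨h1, h2⟩, h3⟩⟩⟩
    cm5b := ⟨fun f => by
      obtain ⟨Z, i, p, h1, h2, h3, h4⟩ := ms.factorization_cof_acyclicFib f
      exact ⟨⟨Z, i, p, h4, h1, ⟨h2, h3⟩⟩⟩⟩ }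

lemma aux_homotopic_iff [HasLimits M] [HasColimits M] (ms : ModelStructure M) {X Y : M}
    (f g : X ⟶ Y) :
    letI := ms.toModelCategory
    Homotopic ms f g ↔ LeftHomotopyRel f g := by
  letI := ms.toModelCategory
  constructor
  · rintro ⟨I, i, p, H, hi, hp, h1, h2⟩
    refine ⟨{ I := I, i₀ := coprod.inl ≫ i, i₁ := coprod.inr ≫ i, π := p,
              i₀_π := by rw [Category.assoc, h1]; exact coprod.inl_desc _ _
              i₁_π := by rw [Category.assoc, h1]; exact coprod.inr_desc _ _
              weakEquivalence_π := ⟨hp⟩ },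
            ⟨{ h := H, h₀ := by rw [Category.assoc, h2]; exact coprod.inl_desc _ _
               h₁ := by rw [Category.assoc, h2]; exact coprod.inr_desc _ _ }⟩⟩
  · intro h
    obtain ⟨P, hP, ⟨h⟩⟩ := h.exists_good_cylinder
    refine ⟨P.I, P.i, P.π, h.h, hP.cofibration_i.mem, P.weakEquivalence_π.mem, ?_, ?_⟩
    · ext
      · simpa using (coprod.inl_desc _ _).symm
      · simpa using (coprod.inr_desc _ _).symm
    · ext
      · simpa [h.h₀] using (coprod.inl_desc _ _).symm
      · simpa [h.h₁] using (coprod.inr_desc _ _).symm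

lemma aux_weq_of_bijective [ModelCategory M] {A B : M} (f : A ⟶ B) [IsCofibrant A] [IsCofibrant B]
    (hf : ∀ (X : M), IsFibrant X →
      Function.Bijective (fun (g : RightHomotopyClass B X) ↦ g.precomp f)) :
    WeakEquivalence f := by
  let dB := MorphismProperty.factorizationData (trivialCofibrations M) (fibrations M)
    (terminal.from B)
  let d := MorphismProperty.factorizationData (trivialCofibrations M) (fibrations M) (f ≫ dB.i)
  obtain ⟨_, _⟩ := (mem_trivialCofibrations_iff _).1 dB.hi
  obtain ⟨_, _⟩ := (mem_trivialCofibrations_iff _).1 d.hi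
  have : Fibration d.p := ⟨d.hp⟩
  have : IsFibrant dB.Z := ⟨by
    have := dB.hp
    rwa [Subsingleton.elim dB.p (terminal.from _)] at this⟩
  have : IsFibrant d.Z := isFibrant_of_fibration d.p
  have : IsCofibrant dB.Z := isCofibrant_of_cofibration dB.i
  have : IsCofibrant d.Z := isCofibrant_of_cofibration d.i
  have hp : ∀ (X : M), IsFibrant X →
      Function.Bijective (fun (g : RightHomotopyClass dB.Z X) ↦ g.precomp d.p) := by
    intro X _
    rw [← Function.Bijective.of_comp_iff'
      (RightHomotopyClass.precomp_bijective_of_cofibration_of_weakEquivalence X d.i)]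
    convert! (hf X inferInstance).comp
      (RightHomotopyClass.precomp_bijective_of_cofibration_of_weakEquivalence X dB.i) using 1
    ext φ
    obtain ⟨φ, rfl⟩ := φ.mk_surjective
    simp
  obtain ⟨g, hg⟩ := (hp d.Z inferInstance).2 (.mk (𝟙 _))
  obtain ⟨g, rfl⟩ := g.mk_surjective
  simp only [RightHomotopyClass.precomp_mk] at hg
  have hg' : RightHomotopyRel (g ≫ d.p) (𝟙 _) := by
    rw [← RightHomotopyClass.mk_eq_mk_iff]
    apply (hp dB.Z inferInstance).1
    simp only [RightHomotopyClass.precomp_mk, Category.comp_id]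
    rw [RightHomotopyClass.mk_eq_mk_iff, ← leftHomotopyRel_iff_rightHomotopyRel] at hg ⊢
    simpa using hg.postcomp d.p
  obtain ⟨P, _, ⟨h⟩⟩ := hg'.leftHomotopyRel.exists_good_cylinder
  obtain ⟨g', h', hh⟩ := h.covering_homotopy d.p g rfl
  have hg'p : g' ≫ d.p = 𝟙 _ := by
    rw [← h'.h₁, Category.assoc, hh, h.h₁]
  have e : RightHomotopyClass.mk (d.p ≫ g') = .mk (𝟙 _) := by
    rw [← hg]
    exact (RightHomotopyClass.sound (h'.leftHomotopyRel.rightHomotopyRel.precomp d.p)).symm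
  rw [RightHomotopyClass.mk_eq_mk_iff] at e
  obtain ⟨Q, ⟨k⟩⟩ := e
  have hw : WeakEquivalence (d.p ≫ g') := k.weakEquivalence_iff.2 inferInstance
  have r : RetractArrow d.p (d.p ≫ g') :=
    { i := Arrow.homMk (𝟙 _) g' (by simp)
      r := Arrow.homMk (𝟙 _) d.p (by simp [hg'p])
      retract := by ext <;> simp [hg'p] }
  have : WeakEquivalence d.p := ⟨MorphismProperty.of_retract r hw.mem⟩
  have : WeakEquivalence (f ≫ dB.i) := by rw [← d.fac]; infer_instance
  exact weakEquivalence_of_postcomp f dB.i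

end Aux

/-- Let `M` be a model category and `A`, `B` cofibrant objects.
A morphism `f : A ⟶ B` is a weak equivalence if and only if for every fibrant object `X`
and every `α : A ⟶ X` there exists `β : B ⟶ X`, unique up to homotopy, with
`β ∘ f` homotopic to `α`. -/
theorem weq_iff_homotopy_extension
    {M : Type u} [Category.{v} M] [HasLimits M] [HasColimits M]
    (ms : ModelStructure M) {A B : M} (f : A ⟶ B)
    (hA : ms.Cofibrant A) (hB : ms.Cofibrant B) :
    ms.weq f ↔
      ∀ (X : M), ms.Fibrant X → ∀ α : A ⟶ X,
        ∃ β : B ⟶ X, Homotopic ms (f ≫ β) α ∧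
          ∀ β' : B ⟶ X, Homotopic ms (f ≫ β') α → Homotopic ms β' β := by
  letI := ms.toModelCategory
  have : HomotopicalAlgebra.IsCofibrant A := ⟨hA⟩
  have : HomotopicalAlgebra.IsCofibrant B := ⟨hB⟩
  simp only [aux_homotopic_iff]
  constructor
  · intro hf X hX α
    have : HomotopicalAlgebra.IsFibrant X := ⟨hX⟩
    have : HomotopicalAlgebra.WeakEquivalence f := ⟨hf⟩
    have hb := HomotopicalAlgebra.RightHomotopyClass.precomp_bijective_of_weakEquivalence X f
    obtain ⟨β, hβ⟩ := hb.2 (.mk α)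
    obtain ⟨β, rfl⟩ := β.mk_surjective
    simp only [HomotopicalAlgebra.leftHomotopyRel_iff_rightHomotopyRel,
      ← HomotopicalAlgebra.RightHomotopyClass.mk_eq_mk_iff]
    exact ⟨β, hβ, fun β' h' => hb.1 (h'.trans hβ.symm)⟩
  · intro H
    refine (aux_weq_of_bijective f fun X hX => ?_).mem
    have H := H X hX.mem
    simp only [HomotopicalAlgebra.leftHomotopyRel_iff_rightHomotopyRel,
      ← HomotopicalAlgebra.RightHomotopyClass.mk_eq_mk_iff] at H
    constructor
    · intro a b hab
      obtain ⟨a, rfl⟩ := a.mk_surjective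
      obtain ⟨b, rfl⟩ := b.mk_surjective
      obtain ⟨β, h1, h2⟩ := H (f ≫ b)
      exact (h2 a hab).trans (h2 b rfl).symm
    · intro a
      obtain ⟨a, rfl⟩ := a.mk_surjective
      obtain ⟨β, h1, h2⟩ := H a
      exact ⟨.mk β, h1⟩
end

section
/- Let M be a model category and consider a pushout square with i : A → B a cofibration, f : A → C a weak equivalence, and induced pushout maps j : C → D and g : B → D. If A, B and C are cofibrant, then g : B → D is a weak equivalence. -/
open CategoryTheory CategoryTheory.Limits

universe w v u v₂ u₂ v₃ u₃

variable {M : Type u} [Category.{v} M]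

namespace ModelStructure

variable (ms : ModelStructure M)

lemma cof_of_llp {A B : M} (i : A ⟶ B)
    (h : ∀ {X Y : M} (p : X ⟶ Y), ms.fib p → ms.weq p → HasLiftingProperty i p) : ms.cof i := by
  obtain ⟨Z, k, p, hk, hp, hpw, fac⟩ := ms.factorization_cof_acyclicFib i
  have := h p hp hpw
  have sq : CommSq k i p (𝟙 B) := ⟨by simp [fac]⟩
  exact ms.cof_retract ⟨𝟙 A, 𝟙 A, sq.lift, p, by simp, by simp, by simp, by simp [fac]⟩ hk

lemma acof_of_llp {A B : M} (i : A ⟶ B)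
    (h : ∀ {X Y : M} (p : X ⟶ Y), ms.fib p → HasLiftingProperty i p) :
    ms.cof i ∧ ms.weq i := by
  obtain ⟨Z, k, p, hk, hkw, hp, fac⟩ := ms.factorization_acyclicCof_fib i
  have := h p hp
  have sq : CommSq k i p (𝟙 B) := ⟨by simp [fac]⟩
  have r : IsRetractOfArrow i k :=
    ⟨𝟙 A, 𝟙 A, sq.lift, p, by simp, by simp, by simp, by simp [fac]⟩
  exact ⟨ms.cof_retract r hk, ms.weq_retract r hkw⟩

lemma cof_pushout {A B C D : M} {i : A ⟶ B} {f : A ⟶ C} {g : B ⟶ D} {j : C ⟶ D}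
    (sq : IsPushout i f g j) (hi : ms.cof i) : ms.cof j := by
  refine ms.cof_of_llp j fun p hp hpw => ?_
  have := ms.lifting_cof_acyclicFib i p hi hp hpw
  exact sq.flip.hasLiftingProperty p

lemma acof_pushout {A B C D : M} {i : A ⟶ B} {f : A ⟶ C} {g : B ⟶ D} {j : C ⟶ D}
    (sq : IsPushout i f g j) (hi : ms.cof i) (hw : ms.weq i) : ms.cof j ∧ ms.weq j := by
  refine ms.acof_of_llp j fun p hp => ?_
  have := ms.lifting_acyclicCof_fib i p hi hw hp
  exact sq.flip.hasLiftingProperty p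

lemma cof_comp {A B C : M} {i : A ⟶ B} {j : B ⟶ C} (hi : ms.cof i) (hj : ms.cof j) :
    ms.cof (i ≫ j) := by
  refine ms.cof_of_llp _ fun p hp hpw => ?_
  have := ms.lifting_cof_acyclicFib i p hi hp hpw
  have := ms.lifting_cof_acyclicFib j p hj hp hpw
  infer_instance

lemma brown [HasColimits M] {A X Y : M} (a : A ⟶ X) (b : A ⟶ Y) (φ : X ⟶ Y)
    (ha : ms.cof a) (hb : ms.cof b) (hφ : ms.weq φ) (w : a ≫ φ = b) :
    ∃ (Z : M) (x : X ⟶ Z) (p : Z ⟶ Y) (y : Y ⟶ Z), ms.cof x ∧ ms.weq x ∧ ms.cof y ∧ ms.weq y ∧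
      x ≫ p = φ ∧ y ≫ p = 𝟙 Y ∧ a ≫ x = b ≫ y := by
  have sq := IsPushout.of_hasPushout a b
  obtain ⟨Z, k, p, hk, hp, hpw, fac⟩ :=
    ms.factorization_cof_acyclicFib (sq.desc φ (𝟙 Y) (by simp [w]))
  have e1 : (pushout.inl a b ≫ k) ≫ p = φ := by simp [fac]
  have e2 : (pushout.inr a b ≫ k) ≫ p = 𝟙 Y := by simp [fac]
  refine ⟨Z, pushout.inl a b ≫ k, p, pushout.inr a b ≫ k,
    ms.cof_comp (ms.cof_pushout sq.flip hb) hk, ms.weq_of_comp_right _ p hpw (by rwa [e1]),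
    ms.cof_comp (ms.cof_pushout sq ha) hk,
    ms.weq_of_comp_right _ p hpw (by rw [e2]; exact ms.weq_of_isIso _ inferInstance),
    e1, e2, by simp [pushout.condition_assoc]⟩

lemma weq_cobase [HasColimits M] {A X Y C X' Y' : M} {a : A ⟶ X} {b : A ⟶ Y} {φ : X ⟶ Y}
    (ha : ms.cof a) (hb : ms.cof b) (hφ : ms.weq φ) (w : a ≫ φ = b)
    {f : A ⟶ C} {gx : X ⟶ X'} {cx : C ⟶ X'} {gy : Y ⟶ Y'} {cy : C ⟶ Y'}
    (sx : IsPushout a f gx cx) (sy : IsPushout b f gy cy) (φ' : X' ⟶ Y')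
    (w1 : gx ≫ φ' = φ ≫ gy) (w2 : cx ≫ φ' = cy) : ms.weq φ' := by
  obtain ⟨Z, x, p, y, hx, hxw, hy, hyw, e1, e2, e3⟩ := ms.brown a b φ ha hb hφ w
  have sz := IsPushout.of_hasPushout x gx
  set gz := pushout.inl x gx
  set x' := pushout.inr x gx
  have hx' := ms.acof_pushout sz hx hxw
  have st : IsPushout (a ≫ x) f gz (cx ≫ x') := (sx.flip.paste_vert sz.flip).flip
  rw [e3] at st
  let y' := sy.desc (y ≫ gz) (cx ≫ x') (by rw [← Category.assoc, st.w])
  have y1 : gy ≫ y' = y ≫ gz := sy.inl_desc _ _ _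
  have y2 : cy ≫ y' = cx ≫ x' := sy.inr_desc _ _ _
  have s2 : IsPushout y gy gz y' := by
    refine (IsPushout.of_top (h₁₁ := f) (v₁₁ := b) (v₁₂ := cy) (h₂₁ := gy) (v₂₁ := y) (v₂₂ := y')
      (h₃₁ := gz) ?_ y1 sy.flip).flip
    rw [y2]; exact st.flip
  have hy' := ms.acof_pushout s2 hy hyw
  let p' := sz.desc (p ≫ gy) φ' (by rw [← Category.assoc, e1, w1])
  have p1 : gz ≫ p' = p ≫ gy := sz.inl_desc _ _ _
  have p2 : x' ≫ p' = φ' := sz.inr_desc _ _ _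
  have yp : y' ≫ p' = 𝟙 _ := by
    apply sy.hom_ext
    · rw [reassoc_of% y1, p1, reassoc_of% e2, Category.comp_id]
    · rw [reassoc_of% y2, p2, w2, Category.comp_id]
  rw [← p2]
  refine ms.weq_comp _ _ hx'.2 (ms.weq_of_comp_left y' p' hy'.2 ?_)
  rw [yp]; exact ms.weq_of_isIso _ inferInstance

lemma weq_section [HasColimits M] {A B C D : M} {i : A ⟶ B} {f : A ⟶ C} {g : B ⟶ D} {j : C ⟶ D}
    (sq : IsPushout i f g j) (hi : ms.cof i) (s : C ⟶ A) (hs : ms.cof s) (hsw : ms.weq s)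
    (e : s ≫ f = 𝟙 C) : ms.weq g := by
  have sE := IsPushout.of_hasPushout s (s ≫ i)
  set l := pushout.inl s (s ≫ i)
  set r := pushout.inr s (s ≫ i)
  have hr := ms.acof_pushout sE hs hsw
  have hl := ms.cof_pushout sE.flip (ms.cof_comp hs hi)
  let ε := sE.desc i (𝟙 B) (by simp)
  have l1 : l ≫ ε = i := sE.inl_desc _ _ _
  have r1 : r ≫ ε = 𝟙 B := sE.inr_desc _ _ _
  have hε : ms.weq ε := ms.weq_of_comp_left r ε hr.2
    (by rw [r1]; exact ms.weq_of_isIso _ inferInstance)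
  let gx := sE.desc (f ≫ s ≫ i) (𝟙 B) (by rw [reassoc_of% e, Category.comp_id])
  have l2 : l ≫ gx = f ≫ s ≫ i := sE.inl_desc _ _ _
  have r2 : r ≫ gx = 𝟙 B := sE.inr_desc _ _ _
  have sx : IsPushout l f gx (s ≫ i) := by
    refine (IsPushout.of_top (h₁₁ := s ≫ i) (v₁₁ := s) (v₁₂ := r) (h₂₁ := l) (v₂₁ := f)
      (v₂₂ := gx) (h₃₁ := s ≫ i) ?_ l2 sE.flip)
    rw [e, r2]; exact IsPushout.of_vert_isIso ⟨by simp⟩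
  refine ms.weq_cobase hl hi hε l1 sx sq g ?_ ?_
  · apply sE.hom_ext
    · rw [reassoc_of% l2, reassoc_of% l1, sq.w, reassoc_of% e]
    · rw [reassoc_of% r2, reassoc_of% r1]
  · rw [Category.assoc, sq.w, reassoc_of% e]

end ModelStructure

/-- In a model category, consider a pushout square with
`i : A ⟶ B` a cofibration and `f : A ⟶ C` a weak equivalence, with induced pushout
maps `g : B ⟶ D` and `j : C ⟶ D`. If `A`, `B`, `C` are cofibrant, then `g` is a weak
equivalence. -/
theorem weq_pushout_of_weq_of_cof
    {M : Type u} [Category.{v} M] [HasLimits M] [HasColimits M]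
    (ms : ModelStructure M) {A B C D : M}
    (i : A ⟶ B) (f : A ⟶ C) (g : B ⟶ D) (j : C ⟶ D)
    (sq : IsPushout i f g j)
    (hi : ms.cof i) (hf : ms.weq f)
    (hA : ms.Cofibrant A) (hB : ms.Cofibrant B) (hC : ms.Cofibrant C) :
    ms.weq g := by
  obtain ⟨Z, x, p, y, hx, hxw, hy, hyw, e1, e2, -⟩ :=
    ms.brown (initial.to A) (initial.to C) f hA hC hf (by simp)
  have s1 := IsPushout.of_hasPushout i x
  have hg1 := ms.acof_pushout s1.flip hx hxw
  have hj1 := ms.cof_pushout s1 hi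
  let q := s1.desc g (p ≫ j) (by rw [reassoc_of% e1, sq.w])
  have q1 : pushout.inl i x ≫ q = g := s1.inl_desc _ _ _
  have q2 : pushout.inr i x ≫ q = p ≫ j := s1.inr_desc _ _ _
  have s2 : IsPushout (pushout.inr i x) p q j := by
    refine (IsPushout.of_top (h₁₁ := i) (v₁₁ := x) (v₁₂ := pushout.inl i x)
      (h₂₁ := pushout.inr i x) (v₂₁ := p) (v₂₂ := q) (h₃₁ := j) ?_ q2 s1)
    rw [e1, q1]; exact sq
  rw [← q1]
  exact ms.weq_comp _ _ hg1.2 (ms.weq_section s2 hj1 y hy hyw e2)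
end

section
/- Let M be a model category. Let A, B : ℕ → M be sequential telescope diagrams with structure maps i_k : A_k → A_{k+1} and j_k : B_k → B_{k+1} all cofibrations, and let f : A → B be a natural transformation such that every component f_k : A_k → B_k is a weak equivalence and all objects A_k, B_k are cofibrant. Then the induced morphism colim_k A_k → colim_k B_k on sequential colimits is a weak equivalence. (This is the sequential, ℕ-indexed case of the paper's statement, which allows transfinite telescopes whose values at limit ordinals are the canonical colimits.) -/
open CategoryTheory CategoryTheory.Limits

universe w v u v₂ u₂ v₃ u₃

variable {M : Type u} [Category.{v} M]

lemma seq_llp {M : Type u} [Category.{v} M] (W : MorphismProperty M) {F C : ℕ ⥤ M} (i : F ⟶ C)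
    (h0 : W.llp (i.app 0))
    (hs : ∀ (n : ℕ) {X Y : M} (p : X ⟶ Y) (_ : W p) (a : F.obj (n + 1) ⟶ X) (w : C.obj n ⟶ X)
      (b : C.obj (n + 1) ⟶ Y), F.map (homOfLE (Nat.le_add_right n 1)) ≫ a = i.app n ≫ w →
      i.app (n + 1) ≫ b = a ≫ p → C.map (homOfLE (Nat.le_add_right n 1)) ≫ b = w ≫ p →
      ∃ l : C.obj (n + 1) ⟶ X, i.app (n + 1) ≫ l = a ∧
        C.map (homOfLE (Nat.le_add_right n 1)) ≫ l = w ∧ l ≫ p = b) :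
    (W.functorCategory ℕ).llp i := by
  intro X Y p hp
  refine ⟨fun {a b} sq => ?_⟩
  have hw : ∀ n, a.app n ≫ p.app n = i.app n ≫ b.app n := fun n => by
    have := congrArg (fun t => NatTrans.app t n) sq.w
    simpa using this
  let St (n : ℕ) := {l : C.obj n ⟶ X.obj n // i.app n ≫ l = a.app n ∧ l ≫ p.app n = b.app n}
  have step : ∀ (n : ℕ) (s : St n), ∃ t : St (n + 1),
      C.map (homOfLE (Nat.le_add_right n 1)) ≫ t.1
        = s.1 ≫ X.map (homOfLE (Nat.le_add_right n 1)) := by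
    rintro n ⟨l, hl1, hl2⟩
    obtain ⟨t, ht1, ht2, ht3⟩ := hs n (p.app (n + 1)) (hp _) (a.app (n + 1))
      (l ≫ X.map (homOfLE (Nat.le_add_right n 1))) (b.app (n + 1))
      (by rw [a.naturality, ← hl1, Category.assoc]) (hw _).symm
      (by rw [b.naturality, ← hl2, Category.assoc, Category.assoc, p.naturality])
    exact ⟨⟨t, ht1, ht3⟩, ht2⟩
  choose nxt hnxt using step
  have := h0 _ (hp 0)
  have sq0 : CommSq (a.app 0) (i.app 0) (p.app 0) (b.app 0) := ⟨hw 0⟩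
  let s : ∀ n, St n := fun n =>
    Nat.rec (motive := St) ⟨sq0.lift, sq0.fac_left, sq0.fac_right⟩ nxt n
  have hss : ∀ n, s (n + 1) = nxt n (s n) := fun n => rfl
  refine ⟨⟨⟨NatTrans.ofSequence (fun n => (s n).1) (fun n => ?_), ?_, ?_⟩⟩⟩
  · rw [hss, hnxt]
  · ext n; exact (s n).2.1
  · ext n; exact (s n).2.2

lemma seq_factor {M : Type u} [Category.{v} M] [HasColimits M] (W : MorphismProperty M)
    (fac : ∀ {X Y : M} (f : X ⟶ Y), ∃ (Z : M) (i : X ⟶ Z) (p : Z ⟶ Y),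
      W.llp i ∧ W p ∧ i ≫ p = f)
    {F G : ℕ ⥤ M} (φ : F ⟶ G) :
    ∃ (C : ℕ ⥤ M) (i : F ⟶ C) (p : C ⟶ G), (W.functorCategory ℕ).llp i ∧
      (∀ n, W.llp (i.app n)) ∧ (∀ n, W (p.app n)) ∧ i ≫ p = φ := by
  let St (n : ℕ) := {d : Σ (Z : M), (F.obj n ⟶ Z) × (Z ⟶ G.obj n) //
    W.llp d.2.1 ∧ W d.2.2 ∧ d.2.1 ≫ d.2.2 = φ.app n}
  have step : ∀ (n : ℕ) (s : St n), ∃ (t : St (n + 1))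
      (u : pushout (F.map (homOfLE (Nat.le_add_right n 1))) s.1.2.1 ⟶ t.1.1),
      W.llp u ∧ pushout.inl _ _ ≫ u = t.1.2.1 ∧
      pushout.inr _ _ ≫ u ≫ t.1.2.2 = s.1.2.2 ≫ G.map (homOfLE (Nat.le_add_right n 1)) := by
    rintro n ⟨⟨Z, i, p⟩, hi, hp, hip⟩
    dsimp only at hi hp hip ⊢
    obtain ⟨Z', u, p', hu, hp', hup⟩ := fac (pushout.desc
      (f := F.map (homOfLE (Nat.le_add_right n 1))) (g := i)
      (φ.app (n + 1)) (p ≫ G.map (homOfLE (Nat.le_add_right n 1)))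
      (by rw [φ.naturality, ← hip, Category.assoc]))
    refine ⟨⟨⟨Z', pushout.inl _ _ ≫ u, p'⟩, ?_, hp', ?_⟩, u, hu, rfl, ?_⟩
    · exact W.llp.comp_mem _ _ (W.llp.pushout_inl _ _ hi) hu
    · exact (Category.assoc _ _ _).trans ((congrArg (_ ≫ ·) hup).trans (pushout.inl_desc _ _ _))
    · exact (congrArg (_ ≫ ·) hup).trans (pushout.inr_desc _ _ _)
  choose nxt u hu hinl hinr using step
  obtain ⟨Z0, i0, p0, hi0, hp0, hip0⟩ := fac (φ.app 0)
  let s : ∀ n, St n := fun n =>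
    Nat.rec (motive := St) ⟨⟨Z0, i0, p0⟩, hi0, hp0, hip0⟩ nxt n
  obtain ⟨Z, i, p, U, hi, hp, hip, hU, hUl, hUr⟩ : ∃ (Z : ℕ → M) (i : ∀ n, F.obj n ⟶ Z n)
      (p : ∀ n, Z n ⟶ G.obj n)
      (U : ∀ n, pushout (F.map (homOfLE (Nat.le_add_right n 1))) (i n) ⟶ Z (n + 1)),
      (∀ n, W.llp (i n)) ∧ (∀ n, W (p n)) ∧ (∀ n, i n ≫ p n = φ.app n) ∧ (∀ n, W.llp (U n)) ∧
      (∀ n, pushout.inl _ _ ≫ U n = i (n + 1)) ∧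
      (∀ n, pushout.inr _ _ ≫ U n ≫ p (n + 1)
        = p n ≫ G.map (homOfLE (Nat.le_add_right n 1))) :=
    ⟨fun n => (s n).1.1, fun n => (s n).1.2.1, fun n => (s n).1.2.2, fun n => u n (s n),
      fun n => (s n).2.1, fun n => (s n).2.2.1, fun n => (s n).2.2.2, fun n => hu n (s n),
      fun n => hinl n (s n), fun n => hinr n (s n)⟩
  clear_value s
  let c (n : ℕ) : Z n ⟶ Z (n + 1) := pushout.inr _ _ ≫ U n
  have hc : ∀ n, (Functor.ofSequence c).map (homOfLE (Nat.le_add_right n 1)) = c n :=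
    Functor.ofSequence_map_homOfLE_succ c
  have key : ∀ (n : ℕ) {X Y : M} (q : X ⟶ Y) (_ : W q) (a : F.obj (n + 1) ⟶ X) (w : Z n ⟶ X)
      (b : Z (n + 1) ⟶ Y), F.map (homOfLE (Nat.le_add_right n 1)) ≫ a = i n ≫ w →
      i (n + 1) ≫ b = a ≫ q → c n ≫ b = w ≫ q →
      ∃ l : Z (n + 1) ⟶ X, i (n + 1) ≫ l = a ∧ c n ≫ l = w ∧ l ≫ q = b := by
    intro n X Y q hq a w b h1 h2 h3
    have := hU n q hq
    have sq : CommSq (pushout.desc a w h1) (U n) q b := ⟨by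
      apply pushout.hom_ext
      · rw [pushout.inl_desc_assoc, ← h2, ← hUl, Category.assoc]
      · rw [pushout.inr_desc_assoc, ← h3]; exact Category.assoc _ _ _⟩
    refine ⟨sq.lift, ?_, ?_, sq.fac_right⟩
    · rw [← hUl, Category.assoc, sq.fac_left, pushout.inl_desc]
    · refine (Category.assoc _ _ _).trans ?_
      rw [sq.fac_left, pushout.inr_desc]
  refine ⟨Functor.ofSequence c,
    NatTrans.ofSequence i (fun n => ?_),
    NatTrans.ofSequence p (fun n => ?_), ?_, hi, hp, ?_⟩
  · rw [hc, ← hUl]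
    exact pushout.condition_assoc _
  · rw [hc]
    exact (Category.assoc _ _ _).trans (hUr n)
  · apply seq_llp
    · exact hi 0
    · intro n X Y q hq a w b h1 h2 h3
      rw [hc] at h3 ⊢
      exact key n q hq a w b h1 h2 h3
  · ext n; exact hip n

lemma ModelStructure.weq_of_llp_fib {M : Type u} [Category.{v} M] (ms : ModelStructure M)
    {X Y : M} (g : X ⟶ Y) (hg : ms.fib.llp g) : ms.weq g := by
  obtain ⟨Z, i, q, _, hi, hq, hiq⟩ := ms.factorization_acyclicCof_fib g
  have := hg q hq
  have sq : CommSq i g q (𝟙 Y) := ⟨by simp [hiq]⟩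
  exact ms.weq_retract ⟨𝟙 _, 𝟙 _, sq.lift, q, by simp, sq.fac_right,
    by simp, by simp [hiq]⟩ hi

/-- acyclic fibrations -/
def ModelStructure.afib {M : Type u} [Category.{v} M] (ms : ModelStructure M) :
    MorphismProperty M := fun _ _ p => ms.fib p ∧ ms.weq p

lemma ModelStructure.weq_colimMap_of_llp {M : Type u} [Category.{v} M] [HasColimits M]
    (ms : ModelStructure M) {A C : ℕ ⥤ M} (g : A ⟶ C)
    (hg : (ms.afib.functorCategory ℕ).llp g) (hw : ∀ n, ms.weq (g.app n)) :
    ms.weq (colimMap g) := by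
  obtain ⟨Z, i, q, hi, hi', hq, hiq⟩ := seq_factor ms.fib (fun f => by
    obtain ⟨Z, i, q, hc, hi, hq, hiq⟩ := ms.factorization_acyclicCof_fib f
    exact ⟨Z, i, q, fun _ _ p hp => ms.lifting_acyclicCof_fib i p hc hi hp, hq, hiq⟩) g
  have hqw : ∀ n, ms.weq (q.app n) := fun n => by
    refine ms.weq_of_comp_left (i.app n) _ (ms.weq_of_llp_fib _ (hi' n)) ?_
    rw [← NatTrans.comp_app, hiq]; exact hw n
  have := hg q (fun n => ⟨hq n, hqw n⟩)
  have sq : CommSq i g q (𝟙 C) := ⟨by simp [hiq]⟩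
  have hg' : (ms.fib.functorCategory ℕ).llp g := by
    intro X Y p hp
    have := hi p hp
    refine ⟨fun {a b} sq2 => ?_⟩
    have sq3 : CommSq a i p (q ≫ b) := ⟨by rw [← Category.assoc, hiq, sq2.w]⟩
    refine ⟨⟨⟨sq.lift ≫ sq3.lift, ?_, ?_⟩⟩⟩
    · rw [← Category.assoc, sq.fac_left, sq3.fac_left]
    · rw [Category.assoc, sq3.fac_right, ← Category.assoc, sq.fac_right, Category.id_comp]
  apply ms.weq_of_llp_fib
  intro X Y p hp
  rw [colimMap_eq, colimConstAdj.hasLiftingProperty_iff]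
  exact hg' _ (fun n => hp)

lemma ModelStructure.seq_cofibrant {M : Type u} [Category.{v} M] [HasColimits M]
    (ms : ModelStructure M) (A : ℕ ⥤ M)
    (hi : ∀ n : ℕ, ms.cof (A.map (homOfLE (Nat.le_succ n))))
    (hA : ms.Cofibrant (A.obj 0)) : (ms.afib.functorCategory ℕ).llp (initial.to A) := by
  have hinit : ∀ n, IsInitial ((⊥_ (ℕ ⥤ M)).obj n) := fun n =>
    IsInitial.isInitialObj ((evaluation ℕ M).obj n) _ initialIsInitial
  apply seq_llp
  · intro X Y p hp
    have := ms.lifting_cof_acyclicFib _ p hA hp.1 hp.2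
    refine ⟨fun {a b} sq => ?_⟩
    have sq2 : CommSq (initial.to X) (initial.to (A.obj 0)) p b :=
      ⟨initialIsInitial.hom_ext _ _⟩
    exact ⟨⟨⟨sq2.lift, (hinit 0).hom_ext _ _, sq2.fac_right⟩⟩⟩
  · intro n X Y p hp a w b _ _ h3
    have := ms.lifting_cof_acyclicFib _ p (hi n) hp.1 hp.2
    have sq2 : CommSq w (A.map (homOfLE (Nat.le_succ n))) p b := ⟨h3.symm⟩
    exact ⟨sq2.lift, (hinit _).hom_ext _ _, sq2.fac_left, sq2.fac_right⟩

/-- Let `A, B : ℕ ⥤ M` be sequential telescope diagrams whose structure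
maps are all cofibrations, and let `f : A ⟶ B` be a natural transformation whose
components are weak equivalences between cofibrant objects. Then the induced morphism
on sequential colimits is a weak equivalence. -/
theorem weq_colimMap_of_telescope
    {M : Type u} [Category.{v} M] [HasLimits M] [HasColimits M]
    (ms : ModelStructure M) (A B : ℕ ⥤ M) (f : A ⟶ B)
    (hi : ∀ n : ℕ, ms.cof (A.map (homOfLE (Nat.le_succ n))))
    (hj : ∀ n : ℕ, ms.cof (B.map (homOfLE (Nat.le_succ n))))
    (hf : ∀ n : ℕ, ms.weq (f.app n))
    (hA : ∀ n : ℕ, ms.Cofibrant (A.obj n)) (hB : ∀ n : ℕ, ms.Cofibrant (B.obj n)) :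
    ms.weq (colimMap f) := by
  have cA := ms.seq_cofibrant A hi (hA 0)
  have cB := ms.seq_cofibrant B hj (hB 0)
  have hpo := IsPushout.of_hasBinaryCoproduct' A B
  have hl : (ms.afib.functorCategory ℕ).llp (coprod.inl : A ⟶ A ⨿ B) :=
    MorphismProperty.of_isPushout hpo cB
  have hr : (ms.afib.functorCategory ℕ).llp (coprod.inr : B ⟶ A ⨿ B) :=
    MorphismProperty.of_isPushout hpo.flip cA
  obtain ⟨C, i, p, hi1, -, hp, hip⟩ := seq_factor ms.afib (fun f => by
    obtain ⟨Z, i, q, hc, hq, hqw, hiq⟩ := ms.factorization_cof_acyclicFib f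
    exact ⟨Z, i, q, fun _ _ p hp => ms.lifting_cof_acyclicFib i p hc hp.1 hp.2,
      ⟨hq, hqw⟩, hiq⟩) (coprod.desc f (𝟙 B))
  have e1 : (coprod.inl ≫ i) ≫ p = f := by
    rw [Category.assoc, hip]; exact coprod.inl_desc _ _
  have e2 : (coprod.inr ≫ i) ≫ p = 𝟙 B := by
    rw [Category.assoc, hip]; exact coprod.inr_desc _ _
  have w1 : ms.weq (colimMap (coprod.inl ≫ i)) :=
    ms.weq_colimMap_of_llp _ (MorphismProperty.comp_mem _ _ _ hl hi1) fun n => by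
      refine ms.weq_of_comp_right _ (p.app n) (hp n).2 ?_
      rw [← NatTrans.comp_app, e1]; exact hf n
  have w2 : ms.weq (colimMap (coprod.inr ≫ i)) :=
    ms.weq_colimMap_of_llp _ (MorphismProperty.comp_mem _ _ _ hr hi1) fun n => by
      refine ms.weq_of_comp_right _ (p.app n) (hp n).2 ?_
      rw [← NatTrans.comp_app, e2]; exact ms.weq_of_isIso _ (by dsimp; infer_instance)
  have w3 : ms.weq (colimMap p) := by
    refine ms.weq_of_comp_left _ _ w2 ?_
    rw [colimMap_eq, colimMap_eq, ← Functor.map_comp, e2]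
    exact ms.weq_of_isIso _ inferInstance
  rw [colimMap_eq, ← e1, Functor.map_comp]
  exact ms.weq_comp _ _ w1 w3
end

section
/- Let M be a model category and consider a natural transformation f_k : A_k → B_k (k = 0, 1, 2) between pushout diagrams A_0 ← A_1 → A_2 and B_0 ← B_1 → B_2, with induced morphism of pushouts f : colim(A_0 ← A_1 → A_2) → colim(B_0 ← B_1 → B_2). Set M' := colim(B_1 ← A_1 → A_2) and let g : M' → B_2 be the morphism induced by commutativity. Then: (i) if f_0 and g are cofibrations, so is f; (ii) if f_0 and f_1 are acyclic cofibrations, f_2 is a weak equivalence and g is a cofibration, then both g and f are acyclic cofibrations. -/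
open CategoryTheory CategoryTheory.Limits

universe w v u v₂ u₂ v₃ u₃

variable {M : Type u} [Category.{v} M]

theorem ms_cof_of_llp (ms : ModelStructure M) {A B : M} (i : A ⟶ B)
    (h : ∀ {X Y : M} (p : X ⟶ Y), ms.fib p → ms.weq p → HasLiftingProperty i p) :
    ms.cof i := by
  obtain ⟨Z, j, p, hj, hp, hw, fac⟩ := ms.factorization_cof_acyclicFib i
  have := h p hp hw
  have sq : CommSq j i p (𝟙 B) := ⟨by simp [fac]⟩
  exact ms.cof_retract ⟨𝟙 A, 𝟙 A, sq.lift, p, by simp, by simp, by simp, by simp [fac]⟩ hj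

theorem ms_acof_of_llp (ms : ModelStructure M) {A B : M} (i : A ⟶ B)
    (h : ∀ {X Y : M} (p : X ⟶ Y), ms.fib p → HasLiftingProperty i p) :
    ms.cof i ∧ ms.weq i := by
  obtain ⟨Z, j, p, hj, hw, hp, fac⟩ := ms.factorization_acyclicCof_fib i
  have := h p hp
  have sq : CommSq j i p (𝟙 B) := ⟨by simp [fac]⟩
  have r : IsRetractOfArrow i j :=
    ⟨𝟙 A, 𝟙 A, sq.lift, p, by simp, by simp, by simp, by simp [fac]⟩
  exact ⟨ms.cof_retract r hj, ms.weq_retract r hw⟩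

theorem pushout_map_hlp [HasPushouts M] {A₀ A₁ A₂ B₀ B₁ B₂ : M}
    (a₀ : A₁ ⟶ A₀) (a₂ : A₁ ⟶ A₂) (b₀ : B₁ ⟶ B₀) (b₂ : B₁ ⟶ B₂)
    (f₀ : A₀ ⟶ B₀) (f₁ : A₁ ⟶ B₁) (f₂ : A₂ ⟶ B₂)
    (e₀ : a₀ ≫ f₀ = f₁ ≫ b₀) (e₂ : a₂ ≫ f₂ = f₁ ≫ b₂)
    {X Y : M} (p : X ⟶ Y) (h₀ : HasLiftingProperty f₀ p)
    (hg : HasLiftingProperty (pushout.desc b₂ f₂ e₂.symm) p) :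
    HasLiftingProperty (pushout.map a₀ a₂ b₀ b₂ f₀ f₂ f₁ e₀ e₂) p := by
  constructor
  intro u v sq
  have w := sq.w
  have w₀ : pushout.inl a₀ a₂ ≫ u ≫ p = f₀ ≫ pushout.inl b₀ b₂ ≫ v := by
    rw [w]; simp [pushout.inl_desc, pushout.inr_desc, pushout.inl_desc_assoc, pushout.inr_desc_assoc, pushout.map]
  have w₂ : pushout.inr a₀ a₂ ≫ u ≫ p = f₂ ≫ pushout.inr b₀ b₂ ≫ v := by
    rw [w]; simp [pushout.inl_desc, pushout.inr_desc, pushout.inl_desc_assoc, pushout.inr_desc_assoc, pushout.map]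
  have sq₀ : CommSq (pushout.inl a₀ a₂ ≫ u) f₀ p (pushout.inl b₀ b₂ ≫ v) :=
    ⟨by simpa using w₀⟩
  have c : f₁ ≫ b₀ ≫ sq₀.lift = a₂ ≫ pushout.inr a₀ a₂ ≫ u := by
    rw [← Category.assoc, ← e₀, Category.assoc, sq₀.fac_left, pushout.condition_assoc]
  have sq₂ : CommSq (pushout.desc (b₀ ≫ sq₀.lift) (pushout.inr a₀ a₂ ≫ u) c)
      (pushout.desc b₂ f₂ e₂.symm) p (pushout.inr b₀ b₂ ≫ v) := by
    constructor
    apply pushout.hom_ext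
    · simp [pushout.inl_desc, pushout.inr_desc, pushout.inl_desc_assoc, pushout.inr_desc_assoc, pushout.condition_assoc]
    · simpa [pushout.inl_desc, pushout.inr_desc, pushout.inl_desc_assoc, pushout.inr_desc_assoc] using w₂
  have l₁ : b₂ ≫ sq₂.lift = b₀ ≫ sq₀.lift := by
    have := congrArg (pushout.inl f₁ a₂ ≫ ·) sq₂.fac_left
    simpa only [pushout.inl_desc_assoc, pushout.inl_desc] using this
  have l₂ : f₂ ≫ sq₂.lift = pushout.inr a₀ a₂ ≫ u := by
    have := congrArg (pushout.inr f₁ a₂ ≫ ·) sq₂.fac_left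
    simpa only [pushout.inr_desc_assoc, pushout.inr_desc] using this
  refine ⟨⟨⟨pushout.desc sq₀.lift sq₂.lift l₁.symm, ?_, ?_⟩⟩⟩
  · apply pushout.hom_ext
    · simp [pushout.inl_desc, pushout.inr_desc, pushout.inl_desc_assoc, pushout.inr_desc_assoc, pushout.map]
    · simp [pushout.inl_desc, pushout.inr_desc, pushout.inl_desc_assoc, pushout.inr_desc_assoc, pushout.map, l₂]
  · apply pushout.hom_ext <;> simp [pushout.inl_desc, pushout.inr_desc, pushout.inl_desc_assoc, pushout.inr_desc_assoc]

/-- Given a natural transformation `fₖ : Aₖ ⟶ Bₖ` between pushout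
diagrams `A₀ ← A₁ → A₂` and `B₀ ← B₁ → B₂`, let `M' := colim(B₁ ← A₁ → A₂)` and let
`g : M' ⟶ B₂` be the induced map. Then: (i) if `f₀` and `g` are cofibrations, so is the
induced morphism `f` of pushouts; (ii) if `f₀`, `f₁` are acyclic cofibrations, `f₂` is
a weak equivalence and `g` is a cofibration, then `g` and `f` are acyclic
cofibrations. -/
theorem cof_pushout_map
    {M : Type u} [Category.{v} M] [HasLimits M] [HasColimits M]
    (ms : ModelStructure M) {A₀ A₁ A₂ B₀ B₁ B₂ : M}
    (a₀ : A₁ ⟶ A₀) (a₂ : A₁ ⟶ A₂) (b₀ : B₁ ⟶ B₀) (b₂ : B₁ ⟶ B₂)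
    (f₀ : A₀ ⟶ B₀) (f₁ : A₁ ⟶ B₁) (f₂ : A₂ ⟶ B₂)
    (e₀ : a₀ ≫ f₀ = f₁ ≫ b₀) (e₂ : a₂ ≫ f₂ = f₁ ≫ b₂) :
    (ms.cof f₀ → ms.cof (pushout.desc b₂ f₂ e₂.symm) →
        ms.cof (pushout.map a₀ a₂ b₀ b₂ f₀ f₂ f₁ e₀ e₂)) ∧
    (ms.cof f₀ → ms.weq f₀ → ms.cof f₁ → ms.weq f₁ → ms.weq f₂ →
        ms.cof (pushout.desc b₂ f₂ e₂.symm) →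
        (ms.cof (pushout.desc b₂ f₂ e₂.symm) ∧ ms.weq (pushout.desc b₂ f₂ e₂.symm)) ∧
        (ms.cof (pushout.map a₀ a₂ b₀ b₂ f₀ f₂ f₁ e₀ e₂) ∧
          ms.weq (pushout.map a₀ a₂ b₀ b₂ f₀ f₂ f₁ e₀ e₂))) := by
  refine ⟨fun h₀ hg => ms_cof_of_llp ms _ fun p hp hw => pushout_map_hlp _ _ _ _ _ _ _ _ _ p
    (ms.lifting_cof_acyclicFib _ _ h₀ hp hw) (ms.lifting_cof_acyclicFib _ _ hg hp hw), ?_⟩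
  intro h₀ w₀ h₁ w₁ w₂ hg
  have hr : ms.weq (pushout.inr f₁ a₂) := (ms_acof_of_llp ms _ fun p hp => by
    have := ms.lifting_acyclicCof_fib _ p h₁ w₁ hp
    exact (IsPushout.of_hasPushout f₁ a₂).flip.hasLiftingProperty p).2
  have wg : ms.weq (pushout.desc b₂ f₂ e₂.symm) :=
    ms.weq_of_comp_left (pushout.inr f₁ a₂) _ hr (by simpa [pushout.inr_desc] using w₂)
  exact ⟨⟨hg, wg⟩, ms_acof_of_llp ms _ fun p hp => pushout_map_hlp _ _ _ _ _ _ _ _ _ p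
    (ms.lifting_acyclicCof_fib _ _ h₀ w₀ hp) (ms.lifting_acyclicCof_fib _ _ hg wg hp)⟩
end

section
/- Let C be a category with weak equivalences, with localization functor γ_C : C → Ho(C) at its weak equivalences, let M be a model category, and let H : M → C be a functor which is homotopy meaningful on cofibrant objects. Then the total left derived functor of H exists: the functor γ_C ∘ H : M → Ho(C) admits a left derived functor with respect to the weak equivalences of M. It is given on objects by X ↦ γ_C(H(QX)) for any chosen cofibrant replacement Q in M, with the natural transformation to γ_C ∘ H induced by the morphisms H(QX → X). -/
open CategoryTheory CategoryTheory.Limits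

universe w v u v₂ u₂ v₃ u₃

variable {M : Type u} [Category.{v} M]

/-- A category with weak equivalences: a distinguished class of morphisms containing
all isomorphisms and satisfying the two-out-of-three property. -/
structure WeakEquivalences (C : Type u₂) [Category.{v₂} C] where
  W : MorphismProperty C
  W_of_isIso : ∀ {X Y : C} (f : X ⟶ Y), IsIso f → W f
  W_comp : ∀ {X Y Z : C} (f : X ⟶ Y) (g : Y ⟶ Z), W f → W g → W (f ≫ g)
  W_of_comp_left : ∀ {X Y Z : C} (f : X ⟶ Y) (g : Y ⟶ Z), W f → W (f ≫ g) → W g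
  W_of_comp_right : ∀ {X Y Z : C} (f : X ⟶ Y) (g : Y ⟶ Z), W g → W (f ≫ g) → W f

/-- A functor `H : M ⥤ C` from a model category to a category with weak equivalences is
homotopy meaningful on cofibrant objects if it sends weak equivalences between cofibrant
objects of `M` to weak equivalences of `C`. -/
def HomotopyMeaningfulOnCofibrant [HasInitial M] (ms : ModelStructure M)
    {C : Type u₂} [Category.{v₂} C] (wC : WeakEquivalences C) (H : M ⥤ C) : Prop :=
  ∀ {X Y : M} (f : X ⟶ Y),
    ms.Cofibrant X → ms.Cofibrant Y → ms.weq f → wC.W (H.map f)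

/-- `L` together with `τ : L ⟶ Φ` is the (total) left derived functor of `Φ` with
respect to the class `W` of weak equivalences of the source: `L` is homotopy invariant
(it inverts `W`) and `τ` is terminal among natural transformations to `Φ` from homotopy
invariant functors. -/
def IsTotalLeftDerived {D : Type u₂} [Category.{v₂} D] (W : MorphismProperty D)
    {E : Type u₃} [Category.{v₃} E] (Φ : D ⥤ E) (L : D ⥤ E) (τ : L ⟶ Φ) : Prop :=
  (∀ {X Y : D} (f : X ⟶ Y), W f → IsIso (L.map f)) ∧
  (∀ (G : D ⥤ E), (∀ {X Y : D} (f : X ⟶ Y), W f → IsIso (G.map f)) →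
    ∀ (τ' : G ⟶ Φ), ∃! φ : G ⟶ L, φ ≫ τ = τ')

theorem key_eq {M : Type u} [Category.{v} M] [HasLimits M] [HasColimits M]
    (ms : ModelStructure M) {E : Type u₂} [Category.{v₂} E] (F : M ⥤ E)
    (hF : ∀ {X Y : M} (f : X ⟶ Y), ms.Cofibrant X → ms.Cofibrant Y → ms.weq f → IsIso (F.map f))
    (Q : M → M) (q : ∀ X : M, Q X ⟶ X)
    (hQ : ∀ X : M, ms.Cofibrant (Q X))
    (hq : ∀ X : M, ms.fib (q X) ∧ ms.weq (q X))
    {A X Y : M} (hA : ms.Cofibrant A) (p : X ⟶ Y) (hp : ms.fib p) (hp' : ms.weq p)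
    (f g : A ⟶ X) (h : f ≫ p = g ≫ p) : F.map f = F.map g := by
  obtain ⟨Z, i, s, hi, -, hs, his⟩ :=
    ms.factorization_cof_acyclicFib (coprod.desc (𝟙 A) (𝟙 A))
  have := ms.lifting_cof_acyclicFib i p hi hp hp'
  have sq : CommSq (coprod.desc f g) i p (s ≫ f ≫ p) := ⟨by
    rw [← Category.assoc i, his]
    ext <;> simp [h]⟩
  have := ms.lifting_cof_acyclicFib (initial.to A) (q Z) hA (hq Z).1 (hq Z).2
  have sq0 : CommSq (initial.to (Q Z)) (initial.to A) (q Z) (coprod.inl ≫ i) := ⟨by ext⟩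
  have sq1 : CommSq (initial.to (Q Z)) (initial.to A) (q Z) (coprod.inr ≫ i) := ⟨by ext⟩
  have e0 : sq0.lift ≫ (q Z ≫ s) = 𝟙 A := by
    rw [← Category.assoc, sq0.fac_right, Category.assoc, his]; exact coprod.inl_desc _ _
  have e1 : sq1.lift ≫ (q Z ≫ s) = 𝟙 A := by
    rw [← Category.assoc, sq1.fac_right, Category.assoc, his]; exact coprod.inr_desc _ _
  have f0 : sq0.lift ≫ q Z ≫ sq.lift = f := by
    rw [← Category.assoc, sq0.fac_right, Category.assoc, sq.fac_left]; exact coprod.inl_desc _ _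
  have f1 : sq1.lift ≫ q Z ≫ sq.lift = g := by
    rw [← Category.assoc, sq1.fac_right, Category.assoc, sq.fac_left]; exact coprod.inr_desc _ _
  have : IsIso (F.map (q Z ≫ s)) := hF _ (hQ Z) hA (ms.weq_comp _ _ (hq Z).2 hs)
  have e : F.map sq0.lift = F.map sq1.lift := by
    rw [← cancel_mono (F.map (q Z ≫ s)), ← F.map_comp, ← F.map_comp, e0, e1]
  exact (congrArg F.map f0).symm.trans (Eq.trans (by rw [F.map_comp, F.map_comp sq1.lift, e])
    (congrArg F.map f1))

theorem derived_aux {M : Type u} [Category.{v} M] [HasLimits M] [HasColimits M]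
    (ms : ModelStructure M) {E : Type u₂} [Category.{v₂} E] (F : M ⥤ E)
    (hF : ∀ {X Y : M} (f : X ⟶ Y), ms.Cofibrant X → ms.Cofibrant Y → ms.weq f → IsIso (F.map f))
    (Q : M → M) (q : ∀ X : M, Q X ⟶ X)
    (hQ : ∀ X : M, ms.Cofibrant (Q X))
    (hq : ∀ X : M, ms.fib (q X) ∧ ms.weq (q X)) :
    ∃ (L : M ⥤ E) (τ : L ⟶ F), IsTotalLeftDerived ms.weq F L τ ∧
      ∀ X : M, ∃ e : L.obj X ≅ F.obj (Q X), e.hom ≫ F.map (q X) = τ.app X := by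
  have key : ∀ {A Y : M} (_ : ms.Cofibrant A) (f g : A ⟶ Q Y), f ≫ q Y = g ≫ q Y →
      F.map f = F.map g := fun {A Y} hA f g h =>
    key_eq ms F hF Q q hQ hq hA (q Y) (hq Y).1 (hq Y).2 f g h
  have ex : ∀ {X Y : M} (f : X ⟶ Y), ∃ l : Q X ⟶ Q Y, l ≫ q Y = q X ≫ f := by
    intro X Y f
    have := ms.lifting_cof_acyclicFib (initial.to (Q X)) (q Y) (hQ X) (hq Y).1 (hq Y).2
    have sq : CommSq (initial.to (Q Y)) (initial.to (Q X)) (q Y) (q X ≫ f) := ⟨by ext⟩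
    exact ⟨sq.lift, sq.fac_right⟩
  choose l hl using @ex
  let L : M ⥤ E :=
    { obj := fun X => F.obj (Q X)
      map := fun f => F.map (l f)
      map_id := fun X => by
        rw [← F.map_id]
        exact key (hQ X) _ _ (by simp [hl])
      map_comp := fun {X Y Z} f g => by
        rw [← F.map_comp]
        refine key (hQ X) _ _ ?_
        rw [hl, Category.assoc, hl, ← Category.assoc, ← Category.assoc, hl] }
  let τ : L ⟶ F :=
    { app := fun X => F.map (q X)
      naturality := fun X Y f => by
        change F.map (l f) ≫ F.map (q Y) = F.map (q X) ≫ F.map f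
        rw [← F.map_comp, ← F.map_comp, hl] }
  refine ⟨L, τ, ⟨?_, ?_⟩, fun X => ⟨Iso.refl _, Category.id_comp _⟩⟩
  · intro X Y f hf
    refine hF (l f) (hQ X) (hQ Y) (ms.weq_of_comp_right _ (q Y) (hq Y).2 ?_)
    rw [hl]
    exact ms.weq_comp _ _ (hq X).2 hf
  · intro G hG τ'
    have hGq : ∀ X, IsIso (G.map (q X)) := fun X => hG _ (hq X).2
    refine ⟨{ app := fun X => inv (G.map (q X)) ≫ τ'.app (Q X), naturality := ?_ }, ?_, ?_⟩
    · intro X Y f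
      change G.map f ≫ inv (G.map (q Y)) ≫ τ'.app (Q Y)
        = (inv (G.map (q X)) ≫ τ'.app (Q X)) ≫ F.map (l f)
      rw [← cancel_epi (G.map (q X)), Category.assoc, IsIso.hom_inv_id_assoc,
        ← τ'.naturality, ← G.map_comp_assoc, ← hl, G.map_comp_assoc, IsIso.hom_inv_id_assoc]
    · ext X
      change (inv (G.map (q X)) ≫ τ'.app (Q X)) ≫ F.map (q X) = τ'.app X
      rw [Category.assoc, ← τ'.naturality, IsIso.inv_hom_id_assoc]
    · intro φ hφ
      ext X
      change φ.app X = inv (G.map (q X)) ≫ τ'.app (Q X)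
      rw [IsIso.eq_inv_comp, φ.naturality, ← hφ, NatTrans.comp_app]
      congr 1
      exact key (hQ _) _ _ (hl _)

/-- Let `C` be a category with weak equivalences, with localization
`γ_C = wC.W.Q : C ⥤ Ho(C)`, `M` a model category and `H : M ⥤ C` homotopy meaningful on
cofibrant objects. Then for any chosen cofibrant replacement `Q` in `M`, the total left
derived functor of `H` (i.e. the left derived functor of `γ_C ∘ H` with respect to the
weak equivalences of `M`) exists; it is given on objects by `X ↦ γ_C (H (Q X))`, with
the natural transformation to `γ_C ∘ H` induced by the morphisms `H (Q X ⟶ X)`. -/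
theorem exists_totalLeftDerived_of_homotopyMeaningful
    {M : Type u} [Category.{v} M] [HasLimits M] [HasColimits M]
    (ms : ModelStructure M) {C : Type u₂} [Category.{v₂} C]
    (wC : WeakEquivalences C) (H : M ⥤ C)
    (hH : HomotopyMeaningfulOnCofibrant ms wC H)
    -- a chosen cofibrant replacement in `M`
    (Q : M → M) (q : ∀ X : M, Q X ⟶ X)
    (hQ : ∀ X : M, ms.Cofibrant (Q X))
    (hq : ∀ X : M, ms.fib (q X) ∧ ms.weq (q X)) :
    ∃ (L : M ⥤ wC.W.Localization) (τ : L ⟶ H ⋙ wC.W.Q),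
      IsTotalLeftDerived ms.weq (H ⋙ wC.W.Q) L τ ∧
      ∀ X : M, ∃ e : L.obj X ≅ wC.W.Q.obj (H.obj (Q X)),
        e.hom ≫ (H ⋙ wC.W.Q).map (q X) = τ.app X := by
  exact derived_aux ms (H ⋙ wC.W.Q)
    (fun f hX hY hf => MorphismProperty.Q_inverts wC.W _ (hH f hX hY hf)) Q q hQ hq
end

section
/- Let l : M ⇄ D : r be a left model approximation of a category D with weak equivalences. A morphism f : A → B in D is a weak equivalence if and only if rf is a weak equivalence in M. -/
open CategoryTheory CategoryTheory.Limits

universe w v u v₂ u₂ v₃ u₃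

variable {M : Type u} [Category.{v} M]

/-- A left model approximation of a category `D` with weak equivalences `wD`: a model
category `(M, ms)` together with an adjoint pair `l : M ⇄ D : r` such that `r` is
homotopy meaningful, `l` is homotopy meaningful on cofibrant objects, and for every
cofibrant `X` in `M` the adjoint of a weak equivalence `X ⟶ r A` is a weak
equivalence `l X ⟶ A`. -/
structure LeftModelApproximation {M : Type u} [Category.{v} M] [HasInitial M]
    (ms : ModelStructure M) {D : Type u₂} [Category.{v₂} D]
    (wD : WeakEquivalences D) where
  l : M ⥤ D
  r : D ⥤ M
  adj : l ⊣ r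
  r_weq : ∀ {X Y : D} (f : X ⟶ Y), wD.W f → ms.weq (r.map f)
  l_meaningful : ∀ {X Y : M} (f : X ⟶ Y),
    ms.Cofibrant X → ms.Cofibrant Y → ms.weq f → wD.W (l.map f)
  adjoint_weq : ∀ {X : M} {A : D} (φ : X ⟶ r.obj A),
    ms.Cofibrant X → ms.weq φ → wD.W ((adj.homEquiv X A).symm φ)

/-- Let `l : M ⇄ D : r` be a left model approximation. A morphism
`f : A ⟶ B` in `D` is a weak equivalence if and only if `r f` is a weak equivalence
in `M`. -/
theorem weq_iff_r_weq
    {M : Type u} [Category.{v} M] [HasLimits M] [HasColimits M]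
    (ms : ModelStructure M) {D : Type u₂} [Category.{v₂} D]
    (wD : WeakEquivalences D) (appr : LeftModelApproximation ms wD)
    {A B : D} (f : A ⟶ B) :
    wD.W f ↔ ms.weq (appr.r.map f) := by
  refine ⟨appr.r_weq f, fun h => ?_⟩
  obtain ⟨X, i, p, hi, -, hp, -⟩ := ms.factorization_cof_acyclicFib (initial.to (appr.r.obj A))
  have hX : ms.Cofibrant X := by
    have e : initial.to X = i := Subsingleton.elim _ _
    unfold ModelStructure.Cofibrant
    rw [e]
    exact hi
  have h1 := appr.adjoint_weq p hX hp
  have h2 := appr.adjoint_weq (p ≫ appr.r.map f) hX (ms.weq_comp _ _ hp h)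
  rw [Adjunction.homEquiv_naturality_right_symm] at h2
  exact wD.W_of_comp_left _ _ h1 h2
end

section
/- Let l : M ⇄ D : r be a left model approximation of a category D with weak equivalences. Then the class of weak equivalences in D is closed under retracts: if a morphism f of D is a retract of a morphism g in the category of morphisms of D (there are maps exhibiting f as a retract of g in the arrow category) and g is a weak equivalence, then f is a weak equivalence. -/
open CategoryTheory CategoryTheory.Limits

universe w v u v₂ u₂ v₃ u₃

variable {M : Type u} [Category.{v} M]

/-- If `D` (with weak equivalences `wD`) admits a left model
approximation, then the class of weak equivalences of `D` is closed under retracts: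
if `f` is a retract of `g` in the arrow category and `g` is a weak equivalence, then so
is `f`. -/
theorem weq_retract_of_leftModelApproximation
    {M : Type u} [Category.{v} M] [HasLimits M] [HasColimits M]
    (ms : ModelStructure M) {D : Type u₂} [Category.{v₂} D]
    (wD : WeakEquivalences D) (appr : LeftModelApproximation ms wD)
    {X Y X' Y' : D} {f : X ⟶ Y} {g : X' ⟶ Y'}
    (h : IsRetractOfArrow f g) (hg : wD.W g) :
    wD.W f := by
  obtain ⟨a, a', b, b', h1, h2, h3, h4⟩ := h
  have hr : ms.weq (appr.r.map f) := by
    refine ms.weq_retract (g := appr.r.map g) ⟨appr.r.map a, appr.r.map a', appr.r.map b,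
      appr.r.map b', ?_, ?_, ?_, ?_⟩ (appr.r_weq g hg)
    · rw [← Functor.map_comp, h1, CategoryTheory.Functor.map_id]
    · rw [← Functor.map_comp, h2, CategoryTheory.Functor.map_id]
    · rw [← Functor.map_comp, h3, Functor.map_comp]
    · rw [← Functor.map_comp, h4, Functor.map_comp]
  obtain ⟨Q, i, p, hi, -, hp, -⟩ :=
    ms.factorization_cof_acyclicFib (initial.to (appr.r.obj X))
  have hQ : ms.Cofibrant Q := by
    have e : i = initial.to Q := Subsingleton.elim _ _
    rw [e] at hi
    exact hi
  have k1 := appr.adjoint_weq p hQ hp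
  have k2 := appr.adjoint_weq (p ≫ appr.r.map f) hQ (ms.weq_comp _ _ hp hr)
  rw [Adjunction.homEquiv_naturality_right_symm] at k2
  exact wD.W_of_comp_left _ _ k1 k2
end

section
/- Let C be a category with weak equivalences, with localization functor γ_C : C → Ho(C), and let l : M ⇄ D : r be a left model approximation of a category D with weak equivalences which is good for a functor F : D → C, meaning that F ∘ l : M → C is homotopy meaningful on cofibrant objects. Then the total left derived functor of F with respect to the weak equivalences of D exists, and it is computed by the composite D → M → Ho(C) sending X to γ_C(F(l(Q(rX)))), where Q is a cofibrant replacement in M; the natural transformation to γ_C ∘ F is induced by the adjoints lQrX → X of the cofibrant replacements QrX → rX. -/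
open CategoryTheory CategoryTheory.Limits

universe w v u v₂ u₂ v₃ u₃

variable {M : Type u} [Category.{v} M]

namespace GoodApprox

theorem exists_lift [HasLimits M] [HasColimits M] (ms : ModelStructure M)
    {A B X : M} (hA : ms.Cofibrant A) (p : B ⟶ X) (hp : ms.fib p) (hp' : ms.weq p)
    (f : A ⟶ X) : ∃ g : A ⟶ B, g ≫ p = f := by
  have := ms.lifting_cof_acyclicFib (initial.to A) p hA hp hp'
  have sq : CommSq (initial.to B) (initial.to A) p f := ⟨initial.hom_ext _ _⟩
  exact ⟨sq.lift, sq.fac_right⟩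

theorem map_eq [HasLimits M] [HasColimits M] (ms : ModelStructure M)
    {E : Type u₂} [Category.{v₂} E] (H : M ⥤ E)
    (hH : ∀ {X Y : M} (f : X ⟶ Y),
      ms.Cofibrant X → ms.Cofibrant Y → ms.weq f → IsIso (H.map f))
    {A B X : M} (hA : ms.Cofibrant A) (p : B ⟶ X) (hp : ms.fib p) (hp' : ms.weq p)
    (f g : A ⟶ B) (h : f ≫ p = g ≫ p) : H.map f = H.map g := by
  obtain ⟨Z, i, s, hi, _, hs', his⟩ :=
    ms.factorization_cof_acyclicFib (coprod.desc (𝟙 A) (𝟙 A))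
  obtain ⟨Z', i', q, hZ', hq, hq', _⟩ := ms.factorization_cof_acyclicFib (initial.to Z)
  have hcof : ms.Cofibrant Z' := by
    have : i' = initial.to Z' := initial.hom_ext _ _
    rw [this] at hZ'
    exact hZ'
  have h0 : (coprod.inl ≫ i) ≫ s = 𝟙 A := by
    rw [Category.assoc, his, coprod.inl_desc]
  have h1 : (coprod.inr ≫ i) ≫ s = 𝟙 A := by
    rw [Category.assoc, his, coprod.inr_desc]
  have := ms.lifting_cof_acyclicFib i p hi hp hp'
  have sq : CommSq (coprod.desc f g) i p (s ≫ f ≫ p) := ⟨by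
    rw [← Category.assoc, his]
    ext <;> simp [h]⟩
  obtain ⟨k, hk⟩ : ∃ k : Z ⟶ B, i ≫ k = coprod.desc f g := ⟨sq.lift, sq.fac_left⟩
  have hf : (coprod.inl ≫ i) ≫ k = f := by rw [Category.assoc, hk, coprod.inl_desc]
  have hg : (coprod.inr ≫ i) ≫ k = g := by rw [Category.assoc, hk, coprod.inr_desc]
  obtain ⟨j0, e0⟩ := exists_lift ms hA q hq hq' (coprod.inl ≫ i)
  obtain ⟨j1, e1⟩ := exists_lift ms hA q hq hq' (coprod.inr ≫ i)
  have iso : IsIso (H.map (q ≫ s)) := hH _ hcof hA (ms.weq_comp _ _ hq' hs')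
  have hj : H.map j0 = H.map j1 := by
    rw [← cancel_mono (H.map (q ≫ s)), ← H.map_comp, ← H.map_comp,
      ← Category.assoc, ← Category.assoc, e0, e1, h0, h1]
  rw [← hf, ← hg, ← e0, ← e1]
  simp only [Functor.map_comp, hj]

end GoodApprox

/-- Let `C` be a category with weak equivalences (with localization
`γ_C = wC.W.Q`) and let `l : M ⇄ D : r` be a left model approximation of `D` which is
good for `F : D ⥤ C` (i.e. `l ⋙ F` is homotopy meaningful on cofibrant objects). Then
the total left derived functor of `F` with respect to the weak equivalences of `D`
exists; it is computed on objects by `X ↦ γ_C (F (l (Q (r X))))` for a chosen cofibrant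
replacement `Q` in `M`, with the natural transformation to `γ_C ∘ F` induced by the
adjoints `l (Q (r X)) ⟶ X` of the cofibrant replacement maps `Q (r X) ⟶ r X`. -/
theorem exists_totalLeftDerived_of_goodApproximation
    {M : Type u} [Category.{v} M] [HasLimits M] [HasColimits M]
    (ms : ModelStructure M) {D : Type u₂} [Category.{v₂} D]
    (wD : WeakEquivalences D) (appr : LeftModelApproximation ms wD)
    {C : Type u₃} [Category.{v₃} C] (wC : WeakEquivalences C) (F : D ⥤ C)
    (good : HomotopyMeaningfulOnCofibrant ms wC (appr.l ⋙ F))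
    -- a chosen cofibrant replacement in `M`
    (Q : M → M) (q : ∀ X : M, Q X ⟶ X)
    (hQ : ∀ X : M, ms.Cofibrant (Q X))
    (hq : ∀ X : M, ms.fib (q X) ∧ ms.weq (q X)) :
    ∃ (LF : D ⥤ wC.W.Localization) (τ : LF ⟶ F ⋙ wC.W.Q),
      IsTotalLeftDerived wD.W (F ⋙ wC.W.Q) LF τ ∧
      ∀ X : D,
        ∃ e : LF.obj X ≅ wC.W.Q.obj (F.obj (appr.l.obj (Q (appr.r.obj X)))),
          e.hom ≫ (F ⋙ wC.W.Q).map
              ((appr.adj.homEquiv (Q (appr.r.obj X)) X).symm (q (appr.r.obj X))) =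
            τ.app X := by
  classical
  let H : M ⥤ wC.W.Localization := appr.l ⋙ F ⋙ wC.W.Q
  have hH : ∀ {X Y : M} (f : X ⟶ Y),
      ms.Cofibrant X → ms.Cofibrant Y → ms.weq f → IsIso (H.map f) := by
    intro X Y f hX hY hf
    exact wC.W.Q_inverts _ (good f hX hY hf)
  have hlift : ∀ {X Y : D} (f : X ⟶ Y), ∃ g : Q (appr.r.obj X) ⟶ Q (appr.r.obj Y),
      g ≫ q _ = q _ ≫ appr.r.map f := fun f =>
    GoodApprox.exists_lift ms (hQ _) _ (hq _).1 (hq _).2 _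
  choose Qm hQm using @hlift
  have key : ∀ {A Z : M} (hA : ms.Cofibrant A) (f g : A ⟶ Q Z), f ≫ q Z = g ≫ q Z →
      H.map f = H.map g := fun hA f g h =>
    GoodApprox.map_eq ms H hH hA (q _) (hq _).1 (hq _).2 f g h
  let ε : ∀ X : D, appr.l.obj (Q (appr.r.obj X)) ⟶ X := fun X =>
    (appr.adj.homEquiv (Q (appr.r.obj X)) X).symm (q (appr.r.obj X))
  have hε : ∀ X, wD.W (ε X) := fun X => appr.adjoint_weq _ (hQ _) (hq _).2
  have εnat : ∀ {X Y : D} (f : X ⟶ Y), appr.l.map (Qm f) ≫ ε Y = ε X ≫ f := by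
    intro X Y f
    dsimp only [ε]
    rw [← Adjunction.homEquiv_naturality_left_symm, hQm,
      Adjunction.homEquiv_naturality_right_symm]
  let LF : D ⥤ wC.W.Localization :=
    { obj := fun X => H.obj (Q (appr.r.obj X))
      map := fun f => H.map (Qm f)
      map_id := fun X => by
        rw [← H.map_id]
        exact key (hQ _) _ _ (by simp [hQm])
      map_comp := fun f g => by
        rw [← H.map_comp]
        refine key (hQ _) _ _ ?_
        rw [hQm, Category.assoc, hQm, ← Category.assoc, hQm, Functor.map_comp, Category.assoc] }
  let τ : LF ⟶ F ⋙ wC.W.Q :=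
    { app := fun X => (F ⋙ wC.W.Q).map (ε X)
      naturality := fun X Y f => by
        change (F ⋙ wC.W.Q).map (appr.l.map (Qm f)) ≫ _ = _
        rw [← Functor.map_comp, εnat, Functor.map_comp] }
  have LFinv : ∀ {X Y : D} (f : X ⟶ Y), wD.W f → IsIso (LF.map f) := by
    intro X Y f hf
    refine hH _ (hQ _) (hQ _) (ms.weq_of_comp_right _ _ (hq _).2 ?_)
    rw [hQm]
    exact ms.weq_comp _ _ (hq _).2 (appr.r_weq _ hf)
  have hτ : ∀ X : D, LF.map (ε X) = τ.app (appr.l.obj (Q (appr.r.obj X))) := by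
    intro X
    obtain ⟨η, hη⟩ : ∃ η : Q (appr.r.obj X) ⟶
        Q (appr.r.obj (appr.l.obj (Q (appr.r.obj X)))),
        η ≫ q (appr.r.obj (appr.l.obj (Q (appr.r.obj X)))) =
          appr.adj.homEquiv _ _ (𝟙 (appr.l.obj (Q (appr.r.obj X)))) := GoodApprox.exists_lift ms (hQ (appr.r.obj X)) (q _) (hq _).1 (hq _).2 _
    have a1 : H.map η ≫ LF.map (ε X) = 𝟙 _ := by
      change H.map η ≫ H.map (Qm (ε X)) = 𝟙 _
      rw [← H.map_comp, ← H.map_id]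
      refine key (hQ _) _ _ ?_
      rw [Category.assoc, hQm, ← Category.assoc, hη, ← Adjunction.homEquiv_naturality_right]
      simp [ε]
    have a2 : H.map η ≫ τ.app (appr.l.obj (Q (appr.r.obj X))) = 𝟙 _ := by
      change (F ⋙ wC.W.Q).map (appr.l.map η) ≫ (F ⋙ wC.W.Q).map (ε _) = 𝟙 _
      rw [← Functor.map_comp]
      dsimp only [ε]
      rw [← Adjunction.homEquiv_naturality_left_symm, hη,
        Equiv.symm_apply_apply, CategoryTheory.Functor.map_id]
    have := LFinv _ (hε X)
    have : IsIso (H.map η) := by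
      rw [show H.map η = inv (LF.map (ε X)) from IsIso.eq_inv_of_inv_hom_id a1]
      infer_instance
    rw [← cancel_epi (H.map η), a1, a2]
  refine ⟨LF, τ, ⟨LFinv, ?_⟩, fun X => ⟨Iso.refl _, Category.id_comp _⟩⟩
  intro G hG τ'
  have hGε : ∀ X, IsIso (G.map (ε X)) := fun X => hG _ (hε X)
  refine ⟨{ app := fun X => inv (G.map (ε X)) ≫ τ'.app (appr.l.obj (Q (appr.r.obj X)))
            naturality := fun X Y f => ?_ }, ?_, ?_⟩
  · change G.map f ≫ inv (G.map (ε Y)) ≫ _ = (_ ≫ _) ≫ (F ⋙ wC.W.Q).map (appr.l.map (Qm f))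
    rw [Category.assoc, ← τ'.naturality, ← cancel_epi (G.map (ε X)), ← Category.assoc,
      ← G.map_comp, ← εnat, G.map_comp]
    simp
  · ext X
    change (inv (G.map (ε X)) ≫ τ'.app _) ≫ (F ⋙ wC.W.Q).map (ε X) = τ'.app X
    rw [Category.assoc, ← τ'.naturality, IsIso.inv_hom_id_assoc]
  · intro φ hφ
    ext X
    change φ.app X = inv (G.map (ε X)) ≫ τ'.app _
    rw [← cancel_epi (G.map (ε X)), IsIso.hom_inv_id_assoc, φ.naturality, hτ, ← hφ]
    rfl
end

section
/- Let C be a cocomplete category and f : L → K a map of simplicial sets. If F : 𝐋 → C is a bounded diagram, then its pointwise left Kan extension f^k F : 𝐊 → C along the induced functor 𝐋 → 𝐊 between simplex categories is again a bounded diagram. Consequently, left Kan extension restricts to a functor f^k : Fun^b(𝐋, C) → Fun^b(𝐊, C), left adjoint to the restriction functor f* : Fun^b(𝐊, C) → Fun^b(𝐋, C). -/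
open CategoryTheory CategoryTheory.Limits Opposite Simplicial

universe w v u v₂ u₂ v₃ u₃

/-- The simplex category `𝐊` of a simplicial set `K`: objects are the simplices of `K`
and a morphism `σ ⟶ τ` is a map `α : Δ[n] ⟶ Δ[m]` of standard simplices with
`τ ∘ α = σ`.  It is realized as the opposite of the category of elements of `K`. -/
abbrev SimplexCat (K : SSet.{0}) := K.Elementsᵒᵖ

/-- The functor `𝐋 ⥤ 𝐊` between simplex categories induced by a map `f : L ⟶ K` of
simplicial sets. -/
def simplexMap {L K : SSet.{0}} (f : L ⟶ K) :
    SimplexCat L ⥤ SimplexCat K :=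
  (CategoryOfElements.map f).op

/-- A diagram `F : 𝐊 ⥤ C` indexed by the simplex category of a simplicial set is
*bounded* if it sends every morphism of `𝐊` whose underlying map in the simplex
category `Δ` is surjective (in particular, every degeneracy morphism `s_iσ ⟶ σ`) to an
isomorphism of `C`. -/
def BoundedDiagram {C : Type u₂} [Category.{v₂} C] {K : SSet.{0}}
    (F : SimplexCat K ⥤ C) : Prop :=
  ∀ {x y : SimplexCat K} (e : x ⟶ y),
    Function.Surjective e.unop.val.unop.toOrderHom → IsIso (F.map e)

section aux

lemma BD_chain {k : ℕ} {N M : SimplexCategory} (s : N ⟶ M) (a b : SimplexCategory.mk k ⟶ N)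
    (hab : ∀ i, a.toOrderHom i ≤ b.toOrderHom i) (hs : a ≫ s = b ≫ s)
    (P : (SimplexCategory.mk k ⟶ N) → Prop) (hb : P b)
    (hP : ∀ (j : Fin (k+1)) (h : SimplexCategory.mk (k+1) ⟶ N),
      h ≫ s = SimplexCategory.σ j ≫ b ≫ s → P (SimplexCategory.δ j.castSucc ≫ h) →
        P (SimplexCategory.δ j.succ ≫ h)) : P a := by
  have hs' : ∀ i, s.toOrderHom (a.toOrderHom i) = s.toOrderHom (b.toOrderHom i) := fun i => by
    have := congrArg (fun t => t.toOrderHom i) hs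
    simpa using this
  let mix : ℕ → (SimplexCategory.mk k ⟶ N) := fun j => SimplexCategory.Hom.mk
    ⟨fun i => if i.val < j then a.toOrderHom i else b.toOrderHom i, by
      intro i i' hi
      have h1 := a.toOrderHom.monotone hi
      have h2 := b.toOrderHom.monotone hi
      have h3 := hab i'
      have h4 := hab i
      have h5 : i.val ≤ i'.val := hi
      dsimp only
      split_ifs
      · exact h1
      · exact h1.trans h3
      · omega
      · exact h2⟩
  have h0 : mix 0 = b := by
    ext i
    simp [mix]
  have h1 : mix (k+1) = a := by
    ext i
    have : i.val < k + 1 := i.2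
    have : i.val ≤ k := by omega
    simp [mix, this]
  have key : ∀ j, j ≤ k + 1 → P (mix j) := by
    intro j
    induction j with
    | zero => intro _; rw [h0]; exact hb
    | succ j ih =>
      intro hj
      let J : Fin (k+1) := ⟨j, by omega⟩
      have hmono : ∀ i i' : Fin (k+2), i ≤ i' → J.predAbove i ≤ J.predAbove i' :=
        fun i i' h => Fin.predAbove_right_monotone J h
      let h : SimplexCategory.mk (k+1) ⟶ N := SimplexCategory.Hom.mk
        ⟨fun i : Fin (k+2) => if i.val ≤ j then a.toOrderHom (J.predAbove i)
          else b.toOrderHom (J.predAbove i), by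
          intro i i' hi
          have h1 := a.toOrderHom.monotone (hmono i i' hi)
          have h2 := b.toOrderHom.monotone (hmono i i' hi)
          have h3 := hab (J.predAbove i')
          have h5 : i.val ≤ i'.val := hi
          dsimp only
          split_ifs
          · exact h1
          · exact h1.trans h3
          · omega
          · exact h2⟩
      have e1 : SimplexCategory.δ J.castSucc ≫ h = mix j := by
        apply SimplexCategory.Hom.ext
        ext1
        funext i
        change (if (J.castSucc.succAbove i).val ≤ j then
            a.toOrderHom (J.predAbove (J.castSucc.succAbove i))
            else b.toOrderHom (J.predAbove (J.castSucc.succAbove i))) =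
          if i.val < j then a.toOrderHom i else b.toOrderHom i
        have q1 : J.predAbove (J.castSucc.succAbove i) = i := Fin.predAbove_succAbove J i
        rw [q1]
        have q2 : (J.castSucc.succAbove i).val ≤ j ↔ i.val < j := by
          simp only [Fin.succAbove, Fin.lt_def, J]
          split_ifs with h <;> simp at h ⊢ <;> omega
        simp only [q2]
      have e2 : SimplexCategory.δ J.succ ≫ h = mix (j+1) := by
        apply SimplexCategory.Hom.ext
        ext1
        funext i
        change (if (J.succ.succAbove i).val ≤ j then
            a.toOrderHom (J.predAbove (J.succ.succAbove i))
            else b.toOrderHom (J.predAbove (J.succ.succAbove i))) =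
          if i.val < j + 1 then a.toOrderHom i else b.toOrderHom i
        have q1 : J.predAbove (J.succ.succAbove i) = i := by
          have := congrArg (fun t => t.toOrderHom i)
            (SimplexCategory.δ_comp_σ_succ (n := k) (i := J))
          exact this
        rw [q1]
        have q2 : (J.succ.succAbove i).val ≤ j ↔ i.val < j + 1 := by
          simp only [Fin.succAbove, Fin.lt_def, J]
          split_ifs with h <;> simp at h ⊢ <;> omega
        simp only [q2]
      have e3 : h ≫ s = SimplexCategory.σ J ≫ b ≫ s := by
        apply SimplexCategory.Hom.ext
        ext1
        funext i
        change s.toOrderHom (if i.val ≤ j then a.toOrderHom (J.predAbove i)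
          else b.toOrderHom (J.predAbove i)) = s.toOrderHom (b.toOrderHom (J.predAbove i))
        split_ifs
        · exact hs' _
        · rfl
      have := hP J h e3 (by rw [e1]; exact ih (by omega))
      rwa [e2] at this
  rw [← h1]
  exact key _ le_rfl

lemma BD_section {N M : SimplexCategory} (s : N ⟶ M)
    (hs : Function.Surjective s.toOrderHom) :
    ∃ d : M ⟶ N, d ≫ s = 𝟙 M ∧ ∀ i, (s ≫ d).toOrderHom i ≤ i := by
  have : ∀ j, ∃ i, s.toOrderHom i = j ∧ ∀ i', s.toOrderHom i' = j → i ≤ i' := by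
    intro j
    obtain ⟨i, hi, h⟩ := WellFounded.has_min (wellFounded_lt (α := Fin (N.len+1)))
      {i | s.toOrderHom i = j} (hs j)
    exact ⟨i, hi, fun i' h' => not_lt.1 (h i' h')⟩
  choose d hd hd' using this
  refine ⟨SimplexCategory.Hom.mk ⟨d, ?_⟩, ?_, ?_⟩
  · intro j j' hj
    by_contra hlt
    have h := s.toOrderHom.monotone (not_le.1 hlt).le
    rw [hd, hd] at h
    have := le_antisymm hj h
    subst this
    exact hlt le_rfl
  · apply SimplexCategory.Hom.ext
    ext1
    funext j
    exact hd j
  · intro i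
    exact hd' _ i rfl

/-- underlying map -/
def BD_und {K : SSet.{0}} {x y : SimplexCat K} (e : x ⟶ y) :
    x.unop.1.unop ⟶ y.unop.1.unop := e.unop.val.unop

lemma BD_und_inj {K : SSet.{0}} {x y : SimplexCat K} (e e' : x ⟶ y)
    (h : BD_und e = BD_und e') : e = e' := by
  apply Quiver.Hom.unop_inj
  apply CategoryOfElements.ext
  exact Quiver.Hom.unop_inj h

lemma BD_lift {K : SSet.{0}} {x y : SimplexCat K} (φ : x.unop.1.unop ⟶ y.unop.1.unop)
    (h : K.map φ.op y.unop.2 = x.unop.2) : ∃ e : x ⟶ y, BD_und e = φ :=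
  ⟨Quiver.Hom.op (CategoryOfElements.homMk y.unop x.unop φ.op h), rfl⟩

lemma BD_w {K : SSet.{0}} {x y : SimplexCat K} (e : x ⟶ y) :
    K.map (BD_und e).op y.unop.2 = x.unop.2 := e.unop.2

lemma BD_lift_over {K : SSet.{0}} {x y z : SimplexCat K} (e : y ⟶ z) (g : x ⟶ z)
    (φ : x.unop.1.unop ⟶ y.unop.1.unop) (h : φ ≫ BD_und e = BD_und g) :
    ∃ t : x ⟶ y, BD_und t = φ := by
  apply BD_lift
  rw [← BD_w e, ← BD_w g, ← h]
  simp

variable {C : Type u₂} [Category.{v₂} C] {L K : SSet.{0}} (f : L ⟶ K)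
    (F : SimplexCat L ⥤ C) (hF : BoundedDiagram F)
    (F' : SimplexCat K ⥤ C) (α : F ⟶ simplexMap f ⋙ F')

lemma BD_step {τ τ' : SimplexCat L} (q : τ' ⟶ τ)
    (hF : BoundedDiagram F)
    (hq : Function.Surjective (BD_und q).toOrderHom) (a b : τ ⟶ τ')
    (ha : a ≫ q = 𝟙 _) (hb : b ≫ q = 𝟙 _) {x : SimplexCat K}
    (t : (simplexMap f).obj τ' ⟶ x) :
    α.app τ ≫ F'.map ((simplexMap f).map a ≫ t) =
      α.app τ ≫ F'.map ((simplexMap f).map b ≫ t) := by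
  have := hF q hq
  have hab : F.map a = F.map b := by
    rw [← cancel_mono (F.map q), ← F.map_comp, ← F.map_comp, ha, hb]
  have h1 := α.naturality a
  have h2 := α.naturality b
  simp only [Functor.comp_map] at h1 h2
  rw [F'.map_comp, F'.map_comp, ← Category.assoc, ← Category.assoc]
  rw [← h1, ← h2, hab]

lemma BD_main (hF : BoundedDiagram F) {τ : SimplexCat L} {x y : SimplexCat K} (e : x ⟶ y)
    (a b : (simplexMap f).obj τ ⟶ x)
    (hab : ∀ i, (BD_und a).toOrderHom i ≤ (BD_und b).toOrderHom i) (h : a ≫ e = b ≫ e) :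
    α.app τ ≫ F'.map a = α.app τ ≫ F'.map b := by
  obtain ⟨⟨⟨k⟩, t⟩⟩ := τ
  induction k using SimplexCategory.rec with | _ k
  let τ : SimplexCat L := op ⟨op (SimplexCategory.mk k), t⟩
  have key := BD_chain (k := k) (BD_und e) (BD_und a) (BD_und b) hab
    (congrArg BD_und h)
    (fun θ => ∃ c : (simplexMap f).obj τ ⟶ x, BD_und c = θ ∧
      α.app τ ≫ F'.map c = α.app τ ≫ F'.map b) ⟨b, rfl, rfl⟩ ?_
  · obtain ⟨c, hc, hc'⟩ := key
    rw [← BD_und_inj c a hc]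
    exact hc'
  · rintro j h hh ⟨c, hc, hc'⟩
    let τ' : SimplexCat L := op ⟨op (SimplexCategory.mk (k+1)), L.map (SimplexCategory.σ j).op t⟩
    obtain ⟨q, hq⟩ := BD_lift (x := τ') (y := τ) (SimplexCategory.σ j) rfl
    obtain ⟨u, hu⟩ := BD_lift_over (x := τ) (y := τ') q (𝟙 τ) (SimplexCategory.δ j.castSucc)
      (by rw [hq]; exact SimplexCategory.δ_comp_σ_self)
    obtain ⟨v, hv⟩ := BD_lift_over (x := τ) (y := τ') q (𝟙 τ) (SimplexCategory.δ j.succ)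
      (by rw [hq]; exact SimplexCategory.δ_comp_σ_succ)
    obtain ⟨w, hw⟩ := BD_lift_over (x := (simplexMap f).obj τ') (y := x) e
      ((simplexMap f).map q ≫ b ≫ e) h (by
        exact hh.trans (congrArg (fun z => z ≫ BD_und b ≫ BD_und e) hq.symm))
    have hqs : Function.Surjective (BD_und q).toOrderHom := by
      rw [hq]
      exact fun i => ⟨j.castSucc.succAbove i, Fin.predAbove_succAbove j i⟩
    have hstep := BD_step f F F' α q hF hqs u v
      (BD_und_inj _ _ (by
        change BD_und u ≫ BD_und q = 𝟙 _
        rw [hu, hq]; exact SimplexCategory.δ_comp_σ_self))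
      (BD_und_inj _ _ (by
        change BD_und v ≫ BD_und q = 𝟙 _
        rw [hv, hq]; exact SimplexCategory.δ_comp_σ_succ)) w
    refine ⟨(simplexMap f).map v ≫ w, ?_, ?_⟩
    · change BD_und ((simplexMap f).map v) ≫ BD_und w = _
      rw [hw]
      exact congrArg (fun z => z ≫ h) hv
    · rw [← hstep, ← hc']
      congr 2
      apply BD_und_inj
      change BD_und ((simplexMap f).map u) ≫ BD_und w = _
      rw [hw, hc]
      exact congrArg (fun z => z ≫ h) hu

end aux

theorem boundedDiagram_leftKanExtension
    {C : Type u₂} [Category.{v₂} C] [HasColimits C]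
    {L K : SSet.{0}} (f : L ⟶ K)
    (F : SimplexCat L ⥤ C) (hF : BoundedDiagram F)
    (F' : SimplexCat K ⥤ C) (α : F ⟶ simplexMap f ⋙ F')
    [F'.IsLeftKanExtension α] :
    BoundedDiagram F' ∧
      ∀ (G' : SimplexCat K ⥤ C), BoundedDiagram G' →
        BoundedDiagram (simplexMap f ⋙ G') := by
  refine ⟨?_, fun G' hG' x y e he => hG' ((simplexMap f).map e) he⟩
  intro x y e he
  obtain ⟨d, hd, hd'⟩ := BD_section (BD_und e) he
  obtain ⟨d, rfl⟩ := BD_lift_over (x := y) e (𝟙 y) d hd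
  have hde : d ≫ e = 𝟙 y := BD_und_inj _ _ hd
  have : HasColimitsOfSize.{0, 0} C := hasColimitsOfSizeShrink.{0, 0} C
  have hpt : (Functor.LeftExtension.mk F' α).IsPointwiseLeftKanExtension :=
    Functor.isPointwiseLeftKanExtensionOfIsLeftKanExtension F' α
  refine ⟨F'.map d, ?_, by rw [← F'.map_comp, hde, F'.map_id]⟩
  apply (hpt x).hom_ext'
  intro τ φ
  change α.app τ ≫ F'.map φ ≫ F'.map e ≫ F'.map d = α.app τ ≫ F'.map φ ≫ 𝟙 _
  rw [Category.comp_id, ← F'.map_comp, ← F'.map_comp]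
  refine BD_main f F F' α hF e _ _ ?_ ?_
  · intro i
    exact hd' ((BD_und φ).toOrderHom i)
  · simp [hde]
end

section
/- Let C be a cocomplete category, I a small category, and H : I → SSet a diagram of simplicial sets with colimit colim_I H. For each i ∈ I, the canonical map H(i) → colim_I H induces a functor 𝐇(i) → 𝐂, where 𝐂 denotes the simplex category of colim_I H. For any functor F : 𝐂 → C, writing F_i for the restriction of F along 𝐇(i) → 𝐂, the assignments i ↦ colim_{𝐇(i)} F_i form a functor I → C, and the canonical morphism colim_{i ∈ I} colim_{𝐇(i)} F_i → colim_𝐂 F is an isomorphism. -/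
open CategoryTheory CategoryTheory.Limits Opposite Simplicial

universe w v u v₂ u₂ v₃ u₃

theorem simplexMap_surj {I : Type} [SmallCategory I] (H : I ⥤ SSet.{0})
    (z : SimplexCat (colimit H)) :
    ∃ (i : I) (x : SimplexCat (H.obj i)), (simplexMap (colimit.ι H i)).obj x = z := by
  induction z using Opposite.rec with | _ z
  obtain ⟨n, s⟩ := z
  obtain ⟨i, y, hy⟩ := Types.jointly_surjective_of_isColimit
    (isColimitOfPreserves ((evaluation _ _).obj n) (colimit.isColimit H)) s
  refine ⟨i, op ⟨n, y⟩, ?_⟩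
  subst hy
  rfl

theorem simplexMap_lift {L K : SSet.{0}} (f : L ⟶ K) (z : SimplexCat K) (x' : SimplexCat L)
    (e : z ⟶ (simplexMap f).obj x') :
    ∃ (x : SimplexCat L) (e' : x ⟶ x') (h : (simplexMap f).obj x = z),
      e = eqToHom h.symm ≫ (simplexMap f).map e' := by
  induction z using Opposite.rec with | _ z
  induction x' using Opposite.rec with | _ x'
  obtain ⟨n, s⟩ := z
  obtain ⟨m, y⟩ := x'
  induction e using Opposite.rec with | _ e
  obtain ⟨a, ha⟩ := e
  change m ⟶ n at a
  change K.map a (f.app m y) = s at ha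
  have hs : s = f.app n (L.map a y) := by
    rw [← ha]
    exact (NatTrans.naturality_apply f a y).symm
  subst hs
  let e' : (op ⟨n, L.map a y⟩ : SimplexCat L) ⟶ op ⟨m, y⟩ := Quiver.Hom.op ⟨a, rfl⟩
  exact ⟨_, e', rfl, (Category.id_comp ((simplexMap f).map e')).symm⟩

theorem simplexMap_heq {C : Type u₂} [Category.{v₂} C]
    {I : Type} [SmallCategory I] (H : I ⥤ SSet.{0})
    (F : SimplexCat (colimit H) ⥤ C) (c : C)
    (φ : ∀ (i : I) (x : SimplexCat (H.obj i)), F.obj ((simplexMap (colimit.ι H i)).obj x) ⟶ c)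
    (compat : ∀ {i j : I} (a : i ⟶ j) (x : SimplexCat (H.obj i)),
      HEq (φ i x) (φ j ((simplexMap (H.map a)).obj x)))
    {i j : I} (x : SimplexCat (H.obj i)) (y : SimplexCat (H.obj j))
    (h : (simplexMap (colimit.ι H i)).obj x = (simplexMap (colimit.ι H j)).obj y) :
    HEq (φ i x) (φ j y) := by
  induction x using Opposite.rec with | _ x
  induction y using Opposite.rec with | _ y
  obtain ⟨n, x⟩ := x
  obtain ⟨m, y⟩ := y
  have h' : (⟨n, (colimit.ι H i).app n x⟩ : (colimit H).Elements)
    = ⟨m, (colimit.ι H j).app m y⟩ := congrArg unop h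
  obtain ⟨rfl, h2⟩ := Sigma.mk.inj h'
  have h3 := eq_of_heq h2
  have hb := ((Types.isColimit_iff_coconeTypesIsColimit _).1
    ⟨isColimitOfPreserves ((evaluation _ _).obj n) (colimit.isColimit H)⟩).bijective.1
  have key : Relation.EqvGen (H ⋙ (evaluation _ _).obj n).ColimitTypeRel ⟨i, x⟩ ⟨j, y⟩ :=
    (Functor.ιColimitType_eq_iff _ _ _).1
      (@hb (Functor.ιColimitType _ i x) (Functor.ιColimitType _ j y) h3)
  have gen : ∀ p q : (Σ k, (H ⋙ (evaluation _ _).obj n).obj k),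
      Relation.EqvGen (H ⋙ (evaluation _ _).obj n).ColimitTypeRel p q →
      HEq (φ p.1 (op ⟨n, p.2⟩)) (φ q.1 (op ⟨n, q.2⟩)) := by
    intro p q hpq
    induction hpq with
    | rel p q hr =>
      obtain ⟨k, p⟩ := p
      obtain ⟨l, q⟩ := q
      obtain ⟨a, ha⟩ := hr
      change k ⟶ l at a
      change (H.obj k).obj n at p
      change (H.obj l).obj n at q
      change q = (H.map a).app n p at ha
      subst ha
      exact compat a (op ⟨n, p⟩)
    | refl => exact HEq.rfl
    | symm _ _ _ ih => exact ih.symm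
    | trans _ _ _ _ _ ih1 ih2 => exact ih1.trans ih2
  exact gen ⟨i, x⟩ ⟨j, y⟩ key

/-- Let `C` be cocomplete, `I` a small category and `H : I ⥤ SSet`
with colimit `colim_I H`; write `𝐂` for the simplex category of `colim_I H` and, for
`F : 𝐂 ⥤ C`, write `F_i` for the restriction of `F` along the functor
`𝐇(i) ⥤ 𝐂` induced by the canonical map `H(i) ⟶ colim_I H`.  Then `colim_𝐂 F`,
together with the canonical maps `colim_{𝐇(i)} F_i ⟶ colim_𝐂 F`, is the colimit of the
diagram `i ↦ colim_{𝐇(i)} F_i`: for every compatible family of morphisms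
`t_i : colim_{𝐇(i)} F_i ⟶ c` there is a unique `m : colim_𝐂 F ⟶ c` through which all
the `t_i` factor.  In particular the canonical morphism
`colim_{i ∈ I} colim_{𝐇(i)} F_i ⟶ colim_𝐂 F` is an isomorphism. -/
theorem colimit_simplexCat_colimit
    {C : Type u₂} [Category.{v₂} C] [HasColimits C]
    {I : Type} [SmallCategory I] (H : I ⥤ SSet.{0})
    (F : SimplexCat (colimit H) ⥤ C) (c : C)
    (t : ∀ i : I, colimit (simplexMap (colimit.ι H i) ⋙ F) ⟶ c)
    (compat : ∀ {i j : I} (a : i ⟶ j) (x : SimplexCat (H.obj i)),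
      colimit.ι (simplexMap (colimit.ι H i) ⋙ F) x ≫ t i =
        eqToHom (by rw [← colimit.w H a]; rfl) ≫
          colimit.ι (simplexMap (colimit.ι H j) ⋙ F)
            ((simplexMap (H.map a)).obj x) ≫ t j) :
    ∃! m : colimit F ⟶ c,
      ∀ i : I, colimit.pre F (simplexMap (colimit.ι H i)) ≫ m = t i := by
  have hcomp : ∀ {i j : I} (a : i ⟶ j) (x : SimplexCat (H.obj i)),
      HEq (colimit.ι (simplexMap (colimit.ι H i) ⋙ F) x ≫ t i)
        (colimit.ι (simplexMap (colimit.ι H j) ⋙ F)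
            ((simplexMap (H.map a)).obj x) ≫ t j) := by
    intro i j a x
    rw [compat a x]
    exact eqToHom_comp_heq _ _
  have hheq := @simplexMap_heq C _ I _ H F c
    (fun i x => colimit.ι (simplexMap (colimit.ι H i) ⋙ F) x ≫ t i) hcomp
  have hg : ∀ z : SimplexCat (colimit H), ∃ g : F.obj z ⟶ c,
      ∀ (i : I) (x : SimplexCat (H.obj i)), (simplexMap (colimit.ι H i)).obj x = z →
        HEq g (colimit.ι (simplexMap (colimit.ι H i) ⋙ F) x ≫ t i) := by
    intro z
    obtain ⟨i, x, rfl⟩ := simplexMap_surj H z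
    exact ⟨colimit.ι (simplexMap (colimit.ι H i) ⋙ F) x ≫ t i,
      fun j y h => hheq x y h.symm⟩
  choose g hg using hg
  have hg' : ∀ (i : I) (x : SimplexCat (H.obj i)),
      g ((simplexMap (colimit.ι H i)).obj x) =
        colimit.ι (simplexMap (colimit.ι H i) ⋙ F) x ≫ t i :=
    fun i x => eq_of_heq (hg _ i x rfl)
  have nat : ∀ {z z' : SimplexCat (colimit H)} (e : z ⟶ z'), F.map e ≫ g z' = g z := by
    intro z z' e
    obtain ⟨i, x', rfl⟩ := simplexMap_surj H z'
    obtain ⟨x, e', rfl, rfl⟩ := simplexMap_lift _ z x' e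
    rw [eqToHom_refl, Category.id_comp, hg', hg', ← Category.assoc]
    congr 1
    exact colimit.w (simplexMap (colimit.ι H i) ⋙ F) e'
  refine ⟨colimit.desc F ⟨c, ⟨g, fun _ _ e => by simpa using nat e⟩⟩, ?_, ?_⟩
  · intro i
    refine colimit.hom_ext fun x => ?_
    rw [← Category.assoc, colimit.ι_pre, colimit.ι_desc]
    exact hg' i x
  · intro m hm
    refine colimit.hom_ext fun z => ?_
    rw [colimit.ι_desc]
    obtain ⟨i, x, rfl⟩ := simplexMap_surj H z
    refine Eq.trans ?_ (hg' i x).symm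
    rw [← hm i, ← Category.assoc, colimit.ι_pre]
end

section
/- Let I be a small category, N(I) its nerve, and 𝐍(I) the simplex category of N(I). The forgetful functor ε : 𝐍(I) → I, which sends an n-simplex of the nerve, i.e. a chain i_n → ⋯ → i_0 of composable morphisms of I, to its target object i_0, and the dual forgetful functor ε : 𝐍(I)^op → I, which sends a chain to its source i_n, are both cofinal with respect to colimits: for every cocomplete category C and every functor F : I → C, the canonical morphisms colim_{𝐍(I)} ε*F → colim_I F and colim_{𝐍(I)^op} ε*F → colim_I F are isomorphisms (equivalently, both functors ε are final functors). -/
open CategoryTheory CategoryTheory.Limits Opposite Simplicial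

universe w v u v₂ u₂ v₃ u₃

lemma nf_aux {C : Type} [SmallCategory C] {x y z : C} (a : x ⟶ y) (b : y ⟶ z) (c : x ⟶ z)
    (h : c = a ≫ b) : 𝟙 x ≫ c = (𝟙 x ≫ a) ≫ 𝟙 y ≫ b := by simp [h]

lemma nf_aux' {C : Type} [SmallCategory C] {x y z : C} (a : x ⟶ y) (b : y ⟶ z) (c : x ⟶ z)
    (h : c = a ≫ b) : c ≫ 𝟙 z = (a ≫ 𝟙 y) ≫ b ≫ 𝟙 z := by simp [h]

def nfEps (I : Type) [SmallCategory I] : (nerve I).Elementsᵒᵖ ⥤ I where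
  obj p := p.unop.2.obj (Fin.last p.unop.1.unop.len)
  map {p q} f := eqToHom (congrArg
    (fun x : ComposableArrows I p.unop.1.unop.len => x.obj (Fin.last _)) f.unop.2.symm) ≫
    q.unop.2.map (homOfLE (Fin.le_last
      (f.unop.1.unop.toOrderHom (Fin.last p.unop.1.unop.len))))
  map_id p := by
    exact (Category.id_comp _).trans (p.unop.2.map_id _)
  map_comp {p q r} f g := by
    obtain ⟨p⟩ := p
    obtain ⟨q⟩ := q
    obtain ⟨r⟩ := r
    obtain ⟨p1, p2⟩ := p
    obtain ⟨q1, q2⟩ := q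
    obtain ⟨r1, r2⟩ := r
    obtain ⟨g, rfl⟩ : ∃ g', g = Quiver.Hom.op g' := ⟨g.unop, rfl⟩
    obtain ⟨f, rfl⟩ : ∃ f', f = Quiver.Hom.op f' := ⟨f.unop, rfl⟩
    obtain ⟨g, hg⟩ := g
    obtain ⟨f, hf⟩ := f
    change r1 ⟶ q1 at g
    change q1 ⟶ p1 at f
    change (nerve I).map g r2 = q2 at hg
    change (nerve I).map f q2 = p2 at hf
    subst hg
    subst hf
    exact nf_aux _ _ _ (r2.map_comp
      (homOfLE (g.unop.toOrderHom.monotone (Fin.le_last (f.unop.toOrderHom (Fin.last _)))))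
      (homOfLE (Fin.le_last (g.unop.toOrderHom (Fin.last _)))))

def nfEps' (I : Type) [SmallCategory I] : (nerve I).Elements ⥤ I where
  obj p := p.2.obj 0
  map {p q} f := p.2.map (homOfLE (Fin.zero_le (f.1.unop.toOrderHom 0))) ≫
    eqToHom (congrArg
    (fun x : ComposableArrows I q.1.unop.len => x.obj 0) f.2)
  map_id p := by
    exact (Category.comp_id _).trans (p.2.map_id _)
  map_comp {p q r} f g := by
    obtain ⟨p1, p2⟩ := p
    obtain ⟨q1, q2⟩ := q
    obtain ⟨r1, r2⟩ := r
    obtain ⟨g, hg⟩ := g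
    obtain ⟨f, hf⟩ := f
    change q1 ⟶ r1 at g
    change p1 ⟶ q1 at f
    change (nerve I).map g q2 = r2 at hg
    change (nerve I).map f p2 = q2 at hf
    subst hf
    subst hg
    exact nf_aux' _ _ _ (p2.map_comp
      (homOfLE (Fin.zero_le (f.unop.toOrderHom 0)))
      (homOfLE (f.unop.toOrderHom.monotone (Fin.zero_le (g.unop.toOrderHom 0)))))

def nfC0 {I : Type} [SmallCategory I] (j : I) : (nerve I).Elements :=
  ⟨op ⦋0⦌, ComposableArrows.mk₀ j⟩

def nfC1 {I : Type} [SmallCategory I] {i j : I} (g : i ⟶ j) : (nerve I).Elements :=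
  ⟨op ⦋1⦌, ComposableArrows.mk₁ g⟩

def nfV {I : Type} [SmallCategory I] (p : (nerve I).Elements)
    (a : Fin (p.1.unop.len + 1)) : p ⟶ nfC0 (p.2.obj a) :=
  ⟨(SimplexCategory.const ⦋0⦌ p.1.unop a).op, ComposableArrows.ext₀ rfl⟩

lemma nfEps_V {I : Type} [SmallCategory I] (p : (nerve I).Elements)
    (a : Fin (p.1.unop.len + 1)) :
    (nfEps I).map (nfV p a).op = p.2.map (homOfLE (Fin.le_last a)) :=
  Category.id_comp _

lemma nfEps'_V {I : Type} [SmallCategory I] (p : (nerve I).Elements)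
    (a : Fin (p.1.unop.len + 1)) :
    (nfEps' I).map (nfV p a) = p.2.map (homOfLE (Fin.zero_le a)) :=
  Category.comp_id _

lemma nfEps_final (I : Type) [SmallCategory I] : (nfEps I).Final where
  out i := by
    let base : StructuredArrow i (nfEps I) := StructuredArrow.mk (Y := op (nfC0 i)) (𝟙 i)
    have : Nonempty (StructuredArrow i (nfEps I)) := ⟨base⟩
    have key : ∀ X : StructuredArrow i (nfEps I), Zigzag X base := by
      intro X
      obtain ⟨⟨p⟩, g, rfl⟩ : ∃ (p : (nerve I).Elementsᵒᵖ)
        (g : i ⟶ (nfEps I).obj p), X = StructuredArrow.mk g :=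
        ⟨X.right, X.hom, StructuredArrow.eq_mk X⟩
      let j : I := p.2.obj (Fin.last p.1.unop.len)
      let g' : i ⟶ j := g
      let X1 : StructuredArrow i (nfEps I) := StructuredArrow.mk (Y := op (nfC0 j)) g'
      let X2 : StructuredArrow i (nfEps I) := StructuredArrow.mk (Y := op (nfC1 g')) g'
      have h1 : X1 ⟶ StructuredArrow.mk (S := i) (T := nfEps I) (Y := op p) g :=
        StructuredArrow.homMk (nfV p (Fin.last _)).op (by
          rw [nfEps_V]
          exact (congrArg (g' ≫ ·) (p.2.map_id _)).trans (Category.comp_id _))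
      have h2 : X1 ⟶ X2 := StructuredArrow.homMk (nfV (nfC1 g') (1 : Fin 2)).op (by
          refine (congrArg (g' ≫ ·) (nfEps_V (nfC1 g') (1 : Fin 2))).trans ?_
          exact (congrArg (g' ≫ ·) ((nfC1 g').2.map_id (1 : Fin 2))).trans (Category.comp_id _))
      have h3 : base ⟶ X2 := StructuredArrow.homMk (nfV (nfC1 g') (0 : Fin 2)).op (by
          refine (congrArg (𝟙 i ≫ ·) (nfEps_V (nfC1 g') (0 : Fin 2))).trans ?_
          exact Category.id_comp _)
      exact ((Zigzag.of_inv h1).trans (Zigzag.of_hom h2)).trans (Zigzag.of_inv h3)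
    exact zigzag_isConnected fun X Y => (key X).trans (key Y).symm

lemma nfEps'_final (I : Type) [SmallCategory I] : (nfEps' I).Final where
  out i := by
    let base : StructuredArrow i (nfEps' I) := StructuredArrow.mk (Y := nfC0 i) (𝟙 i)
    have : Nonempty (StructuredArrow i (nfEps' I)) := ⟨base⟩
    have key : ∀ X : StructuredArrow i (nfEps' I), Zigzag X base := by
      intro X
      obtain ⟨p, g, rfl⟩ : ∃ (p : (nerve I).Elements)
        (g : i ⟶ (nfEps' I).obj p), X = StructuredArrow.mk g :=
        ⟨X.right, X.hom, StructuredArrow.eq_mk X⟩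
      let j : I := p.2.obj 0
      let g' : i ⟶ j := g
      let X1 : StructuredArrow i (nfEps' I) := StructuredArrow.mk (Y := nfC0 j) g'
      let X2 : StructuredArrow i (nfEps' I) := StructuredArrow.mk (Y := nfC1 g') (𝟙 i)
      have h1 : StructuredArrow.mk (S := i) (T := nfEps' I) (Y := p) g ⟶ X1 :=
        StructuredArrow.homMk (nfV p 0) (by
          refine (congrArg (g ≫ ·) (nfEps'_V p 0)).trans ?_
          exact (congrArg (g' ≫ ·) (p.2.map_id _)).trans (Category.comp_id _))
      have h2 : X2 ⟶ X1 := StructuredArrow.homMk (nfV (nfC1 g') (1 : Fin 2)) (by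
          refine (congrArg (𝟙 i ≫ ·) (nfEps'_V (nfC1 g') (1 : Fin 2))).trans ?_
          exact Category.id_comp _)
      have h3 : X2 ⟶ base := StructuredArrow.homMk (nfV (nfC1 g') (0 : Fin 2)) (by
          refine (congrArg (𝟙 i ≫ ·) (nfEps'_V (nfC1 g') (0 : Fin 2))).trans ?_
          exact (congrArg (𝟙 i ≫ ·) ((nfC1 g').2.map_id (0 : Fin 2))).trans (Category.comp_id _))
      exact ((Zigzag.of_hom h1).trans (Zigzag.of_inv h2)).trans (Zigzag.of_hom h3)
    exact zigzag_isConnected fun X Y => (key X).trans (key Y).symm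

/-- Let `I` be a small category, `N(I)` its nerve and `𝐍(I)` the
simplex category of the nerve.  The forgetful functor `ε : 𝐍(I) ⥤ I` sending a chain of
composable morphisms to its target object, and the dual forgetful functor
`ε' : 𝐍(I)ᵒᵖ ⥤ I` sending a chain to its source object, are both cofinal with respect
to colimits: they are final functors and, for every cocomplete category `C` and every
functor `F : I ⥤ C`, the canonical morphisms `colim_{𝐍(I)} ε*F ⟶ colim_I F` and
`colim_{𝐍(I)ᵒᵖ} ε*F ⟶ colim_I F` are isomorphisms.
(A chain `x : Fin (n+1) ⥤ I` has target `x.obj (Fin.last n)` and source `x.obj 0`.) -/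
theorem nerve_forget_final
    (I : Type) [SmallCategory I] :
    ∃ (ε : (nerve I).Elementsᵒᵖ ⥤ I) (ε' : (nerve I).Elements ⥤ I),
      (∀ p : (nerve I).Elements, ε.obj (op p) = p.2.obj (Fin.last p.1.unop.len)) ∧
      (∀ p : (nerve I).Elements, ε'.obj p = p.2.obj 0) ∧
      ε.Final ∧ ε'.Final ∧
      ∀ (C : Type u₂) [Category.{v₂} C] [HasColimits C] (F : I ⥤ C),
        IsIso (colimit.pre F ε) ∧ IsIso (colimit.pre F ε') := by
  have := nfEps_final I
  have := nfEps'_final I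
  refine ⟨nfEps I, nfEps' I, fun _ => rfl, fun _ => rfl, inferInstance, inferInstance, ?_⟩
  intro C _ _ F
  exact ⟨inferInstance, inferInstance⟩
end

section
/- Every map f : L → K of simplicial sets admits a factorization L → red(f) → K, functorial in f, such that: (1) the map red(f) → K is reduced; and (2) for any other factorization L → X → K of f in which X → K is reduced, there exists a unique map of simplicial sets red(f) → X commuting with both factorizations (i.e. the triangles L → red(f) → X and red(f) → X → K commute). -/
open CategoryTheory CategoryTheory.Limits Opposite Simplicial

universe w v u v₂ u₂

/-- A simplex of a simplicial set is degenerate if it is the image of a lower-dimensional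
simplex under a (non-identity) surjective map of the simplex category `Δ`, i.e. if it is
of the form `s_i σ'`. -/
def SSet.IsDegenerateSimplex {K : SSet.{0}} {m : SimplexCategoryᵒᵖ}
    (σ : K.obj m) : Prop :=
  ∃ (m' : SimplexCategory) (α : m.unop ⟶ m') (τ : K.obj (op m')),
    Function.Surjective α.toOrderHom ∧ m'.len < m.unop.len ∧ K.map α.op τ = σ

/-- A map of simplicial sets is *reduced* if it sends non-degenerate simplices to
non-degenerate simplices. -/
def SSet.IsReduced {L K : SSet.{0}} (f : L ⟶ K) : Prop :=
  ∀ (m : SimplexCategoryᵒᵖ) (σ : L.obj m),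
    ¬ SSet.IsDegenerateSimplex σ → ¬ SSet.IsDegenerateSimplex (f.app m σ)

namespace RedFact

lemma isDeg_iff {K : SSet.{0}} {n : ℕ} (σ : K _⦋n⦌) :
    SSet.IsDegenerateSimplex σ ↔ σ ∈ K.degenerate n := by
  rw [SSet.mem_degenerate_iff]
  constructor
  · rintro ⟨m', α, τ, hα, hlt, h⟩
    exact ⟨m'.len, hlt, α, SimplexCategory.epi_iff_surjective.2 hα, τ, h⟩
  · rintro ⟨m, hm, α, hα, τ, h⟩
    exact ⟨⦋m⦌, α, τ, SimplexCategory.epi_iff_surjective.1 hα, hm, h⟩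

lemma nat_app {X K : SSet.{0}} (v : X ⟶ K) {m m' : SimplexCategoryᵒᵖ} (α : m ⟶ m')
    (x : X.obj m) : v.app m' (X.map α x) = K.map α (v.app m x) :=
  NatTrans.naturality_apply v α x

lemma map_map {X : SSet.{0}} {a b c : SimplexCategoryᵒᵖ} (α : a ⟶ b) (β : b ⟶ c)
    (x : X.obj a) : X.map β (X.map α x) = X.map (α ≫ β) x := by
  rw [Functor.map_comp]; rfl

lemma key {X K : SSet.{0}} (v : X ⟶ K) (hv : SSet.IsReduced v) {n m : ℕ}
    (x : X _⦋n⦌) (α : ⦋n⦌ ⟶ ⦋m⦌) [Epi α] (s : ⦋m⦌ ⟶ ⦋n⦌) (hs : s ≫ α = 𝟙 _)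
    (τ : K _⦋m⦌) (h : v.app _ x = K.map α.op τ) :
    X.map α.op (X.map s.op x) = x := by
  obtain ⟨k, β, hβ, ⟨x', hx'⟩, rfl⟩ := X.exists_nonDegenerate x
  obtain ⟨l, γ, hγ, ⟨τ', hτ'⟩, rfl⟩ := K.exists_nonDegenerate τ
  have hvx : v.app _ x' ∈ K.nonDegenerate k := by
    have := hv (op ⦋k⦌) x' (by rw [isDeg_iff]; exact hx')
    rwa [isDeg_iff] at this
  dsimp only at h
  rw [nat_app, map_map, ← op_comp] at h
  obtain rfl := K.unique_nonDegenerate_dim _ β ⟨_, hvx⟩ rfl (α ≫ γ) ⟨τ', hτ'⟩ h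
  obtain rfl := K.unique_nonDegenerate_map _ β ⟨_, hvx⟩ rfl (α ≫ γ) ⟨τ', hτ'⟩ h
  dsimp only
  rw [map_map, map_map, ← op_comp, ← op_comp]
  congr 3
  rw [Category.assoc, reassoc_of% hs]

/-- The relation on simplices of the source of `f`. -/
def rel (f : Arrow SSet.{0}) (m : SimplexCategoryᵒᵖ) : Setoid (f.left.obj m) where
  r x y := ∀ (X K : SSet.{0}) (v : X ⟶ K) (u : f.left ⟶ X) (b : f.right ⟶ K),
    SSet.IsReduced v → u ≫ v = f.hom ≫ b → u.app m x = u.app m y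
  iseqv :=
    { refl := fun _ _ _ _ _ _ _ _ ↦ rfl
      symm := fun h X K v u b hv hc ↦ (h X K v u b hv hc).symm
      trans := fun h h' X K v u b hv hc ↦ (h X K v u b hv hc).trans (h' X K v u b hv hc) }

/-- The reduction of `f`. -/
def redObj (f : Arrow SSet.{0}) : SSet.{0} where
  obj m := Quotient (rel f m)
  map {m m'} α := TypeCat.ofHom (Quotient.map (f.left.map α) (by
    intro x y h X K v u b hv hc
    rw [nat_app, nat_app, h X K v u b hv hc]))
  map_id m := by
    ext x
    induction x using Quotient.inductionOn with | _ x
    exact congrArg (Quotient.mk _) (by simp)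
  map_comp α β := by
    ext x
    induction x using Quotient.inductionOn with | _ x
    exact congrArg (Quotient.mk _) (by simp)

/-- The projection. -/
def toRed (f : Arrow SSet.{0}) : f.left ⟶ redObj f where
  app m := TypeCat.ofHom (Quotient.mk (rel f m))
  naturality _ _ _ := rfl

/-- Universal property. -/
def desc (f : Arrow SSet.{0}) {X K : SSet.{0}} (v : X ⟶ K) (u : f.left ⟶ X) (b : f.right ⟶ K)
    (hv : SSet.IsReduced v) (hc : u ≫ v = f.hom ≫ b) : redObj f ⟶ X where
  app m := TypeCat.ofHom (Quotient.lift (u.app m) (fun _ _ h ↦ h X K v u b hv hc))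
  naturality m m' α := by
    ext x
    induction x using Quotient.inductionOn with | _ x
    exact nat_app u α x

lemma toRed_surj (f : Arrow SSet.{0}) (m : SimplexCategoryᵒᵖ) (x : (redObj f).obj m) :
    ∃ y, (toRed f).app m y = x := Quotient.exists_rep x

lemma red_ext {f : Arrow SSet.{0}} {X : SSet.{0}} {p q : redObj f ⟶ X}
    (h : toRed f ≫ p = toRed f ≫ q) : p = q := by
  apply SSet.hom_ext
  intro m
  ext x
  obtain ⟨y, rfl⟩ := toRed_surj f m x
  exact ConcreteCategory.congr_hom (NatTrans.congr_app h m) y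

lemma toRed_desc (f : Arrow SSet.{0}) {X K : SSet.{0}} (v : X ⟶ K) (u : f.left ⟶ X)
    (b : f.right ⟶ K) (hv : SSet.IsReduced v) (hc : u ≫ v = f.hom ≫ b) :
    toRed f ≫ desc f v u b hv hc = u := rfl

lemma isReduced_id (K : SSet.{0}) : SSet.IsReduced (𝟙 K) := fun _ _ h ↦ h

/-- The map to the target. -/
def ofRed (f : Arrow SSet.{0}) : redObj f ⟶ f.right :=
  desc f (𝟙 _) f.hom (𝟙 _) (isReduced_id _) rfl

lemma fac (f : Arrow SSet.{0}) : toRed f ≫ ofRed f = f.hom := rfl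

lemma isReduced_ofRed (f : Arrow SSet.{0}) : SSet.IsReduced (ofRed f) := by
  rintro ⟨n⟩ σ hσ ⟨m, α, τ, hα, hlt, h⟩
  apply hσ
  induction n using SimplexCategory.rec with | _ n
  induction m using SimplexCategory.rec with | _ m
  change ⦋n⦌ ⟶ ⦋m⦌ at α
  obtain ⟨x, rfl⟩ := toRed_surj f _ σ
  have : Epi α := SimplexCategory.epi_iff_surjective.2 hα
  obtain ⟨⟨s, hs⟩⟩ := isSplitEpi_of_epi α
  refine ⟨⦋m⦌, α, (toRed f).app _ (f.left.map s.op x), hα, hlt, ?_⟩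
  rw [← nat_app]
  refine Quotient.sound (s := rel f _) ?_
  intro X K v u b hv hc
  rw [nat_app, nat_app]
  refine key v hv _ α s hs (b.app _ τ) ?_
  rw [← nat_app b, h]
  exact ConcreteCategory.congr_hom (NatTrans.congr_app hc _) x

/-- Functoriality. -/
def redMap {f g : Arrow SSet.{0}} (φ : f ⟶ g) : redObj f ⟶ redObj g :=
  desc f (ofRed g) (φ.left ≫ toRed g) φ.right (isReduced_ofRed g) (by
    rw [Category.assoc, fac, Arrow.w])

lemma toRed_map {f g : Arrow SSet.{0}} (φ : f ⟶ g) :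
    toRed f ≫ redMap φ = φ.left ≫ toRed g := rfl

/-- The reduction functor. -/
def redFunctor : Arrow SSet.{0} ⥤ SSet.{0} where
  obj f := redObj f
  map φ := redMap φ
  map_id f := red_ext (by rw [toRed_map]; simp)
  map_comp φ ψ := red_ext (by
    rw [toRed_map, ← Category.assoc, toRed_map, Category.assoc, toRed_map]; simp)

end RedFact

open RedFact in
/-- Every map `f : L ⟶ K` of simplicial sets admits a factorization
`L ⟶ red(f) ⟶ K`, functorial in `f` (i.e. given by a functor on the arrow category
with natural transformations from the source and to the target functors), such that
(1) `red(f) ⟶ K` is reduced, and (2) for any other factorization `L ⟶ X ⟶ K` of `f`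
with `X ⟶ K` reduced there is a unique map `red(f) ⟶ X` commuting with both
factorizations. -/
theorem exists_reduction_factorization :
    ∃ (red : Arrow SSet.{0} ⥤ SSet.{0})
      (ι : Arrow.leftFunc ⟶ red) (π : red ⟶ Arrow.rightFunc),
      (∀ f : Arrow SSet.{0}, ι.app f ≫ π.app f = f.hom) ∧
      (∀ f : Arrow SSet.{0}, SSet.IsReduced (π.app f)) ∧
      (∀ (f : Arrow SSet.{0}) (X : SSet.{0}) (u : f.left ⟶ X) (v : X ⟶ f.right),
        u ≫ v = f.hom → SSet.IsReduced v →
        ∃! w : red.obj f ⟶ X, ι.app f ≫ w = u ∧ w ≫ v = π.app f) := by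
  refine ⟨redFunctor, { app := fun f ↦ toRed f, naturality := fun f g φ ↦ (toRed_map φ).symm },
    { app := fun f ↦ ofRed f, naturality := fun f g φ ↦ red_ext (f := f) ?_ },
    fun f ↦ fac f, fun f ↦ isReduced_ofRed f, ?_⟩
  · change toRed f ≫ redMap φ ≫ ofRed g = toRed f ≫ ofRed f ≫ φ.right
    rw [← Category.assoc, toRed_map, Category.assoc, fac, ← Category.assoc, fac, Arrow.w]
  · intro f X u v h hv
    have hc : u ≫ v = f.hom ≫ 𝟙 _ := by rw [h, Category.comp_id]
    refine ⟨desc f v u (𝟙 _) hv hc, ⟨toRed_desc f v u _ hv hc, red_ext (f := f) ?_⟩, ?_⟩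
    · exact h
    · rintro w ⟨hw, -⟩
      exact red_ext (f := f) (hw.trans (toRed_desc f v u _ hv hc).symm)
end
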